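/- arXiv:1801.04643 — 2 statements merged into one kernel-verified Lean document; each statement's English description precedes it below -/
import Mathlib

section
/- For |q|<1, Σ_{n∈ℤ} (-1)^n q^{n²+n}/(1+q^{3n}) = (2q J_{3,18}/J_{9,18} − 1)·Σ_{n∈ℤ} (-1)^n q^{9n²+9n+2}/(1+q^{9n+3}) + J_{3,18}⁶ J₆³ J_{9,18}²/(2 J₁₈⁹). -/
open scoped BigOperators

noncomputable def poch (a q : ℂ) : ℂ := ∏' n : ℕ, (1 - a * q ^ n)

noncomputable def Jm (m : ℕ) (q : ℂ) : ℂ := poch (q ^ m) (q ^ m)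

noncomputable def Jam (a m : ℕ) (q : ℂ) : ℂ :=
  poch (q ^ a) (q ^ m) * poch (q ^ (m - a)) (q ^ m) * poch (q ^ m) (q ^ m)

noncomputable def Sser (a Q : ℂ) : ℂ :=
  ∑' n : ℕ, (1 / (1 - a * Q ^ n) - 1 / (1 - a⁻¹ * Q ^ (n + 1)))

open Filter Topology Complex

lemma summable_norm_neg_mul_pow {Q : ℂ} (hQ : ‖Q‖ < 1) (a : ℂ) :
    Summable fun n : ℕ => ‖-(a * Q ^ n)‖ := by
  simpa [norm_mul, norm_pow] using
    (summable_geometric_of_lt_one (norm_nonneg Q) hQ).mul_left ‖a‖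

lemma multipliable_poch {Q : ℂ} (hQ : ‖Q‖ < 1) (a : ℂ) :
    Multipliable fun n : ℕ => 1 - a * Q ^ n := by
  simpa [sub_eq_add_neg] using
    multipliable_one_add_of_summable (summable_norm_neg_mul_pow hQ a)

lemma differentiable_poch {Q : ℂ} (hQ : ‖Q‖ < 1) :
    Differentiable ℂ fun a => poch a Q := by
  intro a
  have hd : DifferentiableOn ℂ (fun a => poch a Q) (Metric.ball 0 (‖a‖ + 1)) := by
    have hl := Summable.hasProdLocallyUniformlyOn_nat_one_add
      (f := fun n (x : ℂ) => -(x * Q ^ n)) (K := Metric.ball (0 : ℂ) (‖a‖ + 1)) Metric.isOpen_ball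
      ((summable_geometric_of_lt_one (norm_nonneg Q) hQ).mul_left (‖a‖ + 1))
      (.of_forall fun n x hx => by
        rw [norm_neg, norm_mul, norm_pow]
        have : ‖x‖ ≤ ‖a‖ + 1 := (mem_ball_zero_iff.1 hx).le
        gcongr) (fun n => by fun_prop)
    have := hl.differentiableOn (.of_forall fun s => by
      simpa [Finset.prod_fn] using DifferentiableOn.finsetProd (fun _ _ => by fun_prop))
      Metric.isOpen_ball
    simpa [poch, sub_eq_add_neg] using this
  exact hd.differentiableAt (Metric.isOpen_ball.mem_nhds (by simp))

lemma poch_step {Q : ℂ} (hQ : ‖Q‖ < 1) (a : ℂ) : poch a Q = (1 - a) * poch (a * Q) Q := by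
  unfold poch
  rw [tprod_eq_zero_mul' ((multipliable_poch hQ (a * Q)).congr fun n => by ring)]
  simp only [pow_zero, mul_one, pow_succ']
  simp only [mul_assoc]

lemma poch_ne_zero {Q : ℂ} (hQ : ‖Q‖ < 1) {a : ℂ} (h : ∀ n : ℕ, a * Q ^ n ≠ 1) :
    poch a Q ≠ 0 := by
  have := tprod_one_add_ne_zero_of_summable (f := fun n : ℕ => -(a * Q ^ n))
    (fun n => by rw [← sub_eq_add_neg]; exact sub_ne_zero.2 (h n).symm)
    (summable_norm_neg_mul_pow hQ a)
  simpa [poch, sub_eq_add_neg] using this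

lemma poch_eq_zero {Q a : ℂ} {n : ℕ} (h : a * Q ^ n = 1) : poch a Q = 0 :=
  tprod_of_exists_eq_zero ⟨n, by simp [h]⟩

lemma poch_self_ne_zero {Q : ℂ} (hQ : ‖Q‖ < 1) : poch Q Q ≠ 0 := by
  refine poch_ne_zero hQ fun n h => ?_
  have := congrArg norm h
  rw [← pow_succ', norm_pow, norm_one] at this
  exact (pow_lt_one₀ (norm_nonneg _) hQ n.succ_ne_zero).ne this

lemma poch_even_mul_odd {Q : ℂ} (hQ : ‖Q‖ < 1) (a : ℂ) :
    poch a Q = poch a (Q ^ 2) * poch (a * Q) (Q ^ 2) := by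
  have hQ2 : ‖Q ^ 2‖ < 1 := by
    rw [norm_pow]; exact pow_lt_one₀ (norm_nonneg _) hQ two_ne_zero
  unfold poch
  rw [← tprod_even_mul_odd (f := fun n : ℕ => 1 - a * Q ^ n)]
  · simp only [pow_mul, pow_succ', mul_assoc]
  · exact (multipliable_poch hQ2 a).congr fun n => by rw [pow_mul]
  · exact (multipliable_poch hQ2 (a * Q)).congr fun n => by ring

lemma poch_mul_poch_neg {Q : ℂ} (hQ : ‖Q‖ < 1) (a : ℂ) :
    poch a Q * poch (-a) Q = poch (a ^ 2) (Q ^ 2) := by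
  unfold poch
  rw [← (multipliable_poch hQ a).tprod_mul (multipliable_poch hQ (-a))]
  exact tprod_congr fun n => by ring

/-- The theta product `(y;Q)_∞ (Q/y;Q)_∞ (Q;Q)_∞`. -/
noncomputable def thetaProd (y Q : ℂ) : ℂ := poch y Q * poch (Q / y) Q * poch Q Q

lemma thetaProd_step {Q : ℂ} (hQ : ‖Q‖ < 1) (y : ℂ) :
    thetaProd y Q = (1 - y) * (poch (y * Q) Q * poch (Q / y) Q * poch Q Q) := by
  rw [thetaProd, poch_step hQ y]; ring

lemma thetaProd_shift {Q : ℂ} (hQ0 : Q ≠ 0) (hQ : ‖Q‖ < 1) {y : ℂ} (hy : y ≠ 0) :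
    thetaProd (Q * y) Q = -(1 / y) * thetaProd y Q := by
  rw [thetaProd_step hQ y, thetaProd, show Q / (Q * y) = 1 / y by field_simp,
    poch_step hQ (1 / y), show 1 / y * Q = Q / y by ring, mul_comm Q y]
  field_simp
  ring

lemma thetaProd_reflect {Q : ℂ} (hQ0 : Q ≠ 0) {y : ℂ} (hy : y ≠ 0) :
    thetaProd (Q / y) Q = thetaProd y Q := by
  rw [thetaProd, thetaProd, show Q / (Q / y) = y by field_simp]; ring

lemma thetaProd_ne_zero {Q : ℂ} (hQ0 : Q ≠ 0) (hQ : ‖Q‖ < 1) {y : ℂ} (hy : y ≠ 0)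
    (h : ∀ k : ℤ, y * Q ^ k ≠ 1) : thetaProd y Q ≠ 0 := by
  refine mul_ne_zero (mul_ne_zero (poch_ne_zero hQ fun n => by simpa using h n)
    (poch_ne_zero hQ fun n hn => h (-(n + 1 : ℕ)) ?_)) (poch_self_ne_zero hQ)
  rw [zpow_neg, zpow_natCast, pow_succ, ← div_eq_mul_inv, div_eq_one_iff_eq (by positivity)]
  field_simp at hn
  rw [← hn]; ring

lemma thetaProd_eq_zero {Q : ℂ} (hQ0 : Q ≠ 0) {y : ℂ} {k : ℤ} (h : y * Q ^ k = 1) :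
    thetaProd y Q = 0 := by
  have hy : y ≠ 0 := by rintro rfl; simp at h
  rw [thetaProd]
  obtain ⟨n, rfl | rfl⟩ := k.eq_nat_or_neg
  · rw [poch_eq_zero (n := n) (by simpa using h)]; simp
  · rcases n with _ | n
    · rw [poch_eq_zero (n := 0) (by simpa using h)]; simp
    · rw [poch_eq_zero (a := Q / y) (n := n)]
      · simp
      · rw [zpow_neg, zpow_natCast, ← div_eq_mul_inv, div_eq_one_iff_eq (by positivity)] at h
        rw [h]; field_simp; ring

lemma differentiableAt_thetaProd {Q : ℂ} (hQ : ‖Q‖ < 1) {y : ℂ} (hy : y ≠ 0) :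
    DifferentiableAt ℂ (fun y => thetaProd y Q) y := by
  have h1 := differentiable_poch hQ y
  have h2 : DifferentiableAt ℂ (fun y => poch (Q / y) Q) y :=
    (differentiable_poch hQ (Q / y)).comp y ((differentiableAt_const Q).div differentiableAt_id hy)
  exact (h1.mul h2).mul_const _

lemma isPreconnected_annulus {r R : ℝ} (hr : 0 < r) (hR : 0 < R) :
    IsPreconnected {x : ℂ | r < ‖x‖ ∧ ‖x‖ < R} := by
  have h : {x : ℂ | r < ‖x‖ ∧ ‖x‖ < R} = exp '' (re ⁻¹' Set.Ioo (Real.log r) (Real.log R)) := by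
    ext x
    simp only [Set.mem_ofPred_eq, Set.mem_image, Set.mem_preimage, Set.mem_Ioo]
    constructor
    · rintro ⟨h1, h2⟩
      have hx : 0 < ‖x‖ := hr.trans h1
      exact ⟨log x, by rw [log_re]; exact ⟨Real.log_lt_log hr h1, Real.log_lt_log hx h2⟩,
        exp_log (norm_pos_iff.1 hx)⟩
    · rintro ⟨u, ⟨h1, h2⟩, rfl⟩
      rw [norm_exp]
      exact ⟨(Real.log_lt_iff_lt_exp hr).1 h1, (Real.lt_log_iff_exp_lt hR).1 h2⟩
  rw [h]
  refine IsPreconnected.image (Convex.isPreconnected ?_) _ continuous_exp.continuousOn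
  exact (convex_Ioo _ _).linear_preimage Complex.reLm

/-- A function holomorphic on an annulus `‖Q‖ < ‖x‖ < ‖Q‖⁻¹` and invariant under `x ↦ Q x` is
constant. -/
lemma exists_const_of_mul_invariant {Q : ℂ} (hQ0 : Q ≠ 0) (hQ : ‖Q‖ < 1) {K : ℂ → ℂ}
    (hK : DifferentiableOn ℂ K {x : ℂ | ‖Q‖ < ‖x‖ ∧ ‖x‖ < ‖Q‖⁻¹})
    (hinv : ∀ x : ℂ, 1 < ‖x‖ → ‖x‖ < ‖Q‖⁻¹ → K (Q * x) = K x) :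
    ∃ c, ∀ x : ℂ, ‖Q‖ < ‖x‖ → ‖x‖ < ‖Q‖⁻¹ → K x = c := by
  have hQp : 0 < ‖Q‖ := norm_pos_iff.2 hQ0
  set W : Set ℂ := {x : ℂ | ‖Q‖ < ‖x‖ ∧ ‖x‖ < ‖Q‖⁻¹} with hW
  obtain ⟨r, hr0, hr⟩ : ∃ r : ℝ, 0 < r ∧ r * r = ‖Q‖ :=
    ⟨√‖Q‖, Real.sqrt_pos.2 hQp, Real.mul_self_sqrt hQp.le⟩
  have hr1 : r < 1 := by nlinarith
  have hQr : ‖Q‖ < r := by nlinarith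
  have hri : 1 < r⁻¹ := (one_lt_inv₀ hr0).2 hr1
  have hrQ : ‖Q‖⁻¹ = r⁻¹ * r⁻¹ := by rw [← hr, mul_inv]
  set S : Set ℂ := {x : ℂ | r ≤ ‖x‖ ∧ ‖x‖ ≤ r⁻¹} with hS
  have hScomp : IsCompact S := by
    refine (isCompact_closedBall (0 : ℂ) r⁻¹).of_isClosed_subset ?_ fun x hx => by
      simpa using hx.2
    exact (isClosed_le continuous_const continuous_norm).inter
      (isClosed_le continuous_norm continuous_const)
  have hSW : S ⊆ W := fun x hx => ⟨hQr.trans_le hx.1, hx.2.trans_lt (by rw [hrQ]; nlinarith)⟩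
  have h1S : (1 : ℂ) ∈ S := by simp [hS, hr1.le, hri.le]
  obtain ⟨c, hcS, hc⟩ := hScomp.exists_isMaxOn ⟨1, h1S⟩ (hK.continuousOn.mono hSW).norm
  have hmax : IsMaxOn (norm ∘ K) W c := by
    intro x hx
    change ‖K x‖ ≤ ‖K c‖
    obtain ⟨hx1, hx2⟩ := hx
    rcases lt_or_ge ‖x‖ r with h | h
    · have hnx : ‖Q⁻¹ * x‖ = ‖Q‖⁻¹ * ‖x‖ := by rw [norm_mul, norm_inv]
      have h1 : 1 < ‖Q⁻¹ * x‖ := by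
        rw [hnx, inv_mul_eq_div, one_lt_div hQp]; exact hx1
      have h2 : ‖Q⁻¹ * x‖ ≤ r⁻¹ := by
        rw [hnx, hrQ, mul_assoc]
        have : r⁻¹ * ‖x‖ ≤ 1 := by rw [inv_mul_eq_div, div_le_one hr0]; exact h.le
        nlinarith
      have := hinv _ h1 (h2.trans_lt (by rw [hrQ]; nlinarith))
      rw [mul_inv_cancel_left₀ hQ0] at this
      rw [this]
      exact hc ⟨hr1.le.trans h1.le, h2⟩
    · rcases le_or_gt ‖x‖ r⁻¹ with h' | h'
      · exact hc ⟨h, h'⟩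
      · rw [← hinv x (hri.trans h') hx2]
        refine hc ⟨?_, ?_⟩
        · rw [norm_mul, ← hr, mul_assoc]
          have : 1 ≤ r * ‖x‖ := by
            rw [inv_lt_iff_one_lt_mul₀ hr0] at h'; linarith
          nlinarith
        · rw [norm_mul]
          have : ‖Q‖ * ‖x‖ < 1 := by
            rw [lt_inv_comm₀ (hQp.trans hx1) hQp, inv_eq_one_div, lt_div_iff₀ (hQp.trans hx1)]
              at hx2
            exact hx2
          linarith
  have hopen : IsOpen W := (isOpen_lt continuous_const continuous_norm).inter
    (isOpen_lt continuous_norm continuous_const)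
  exact ⟨K c, fun x h1 h2 => eqOn_of_isPreconnected_of_isMaxOn_norm
    (isPreconnected_annulus hQp (by positivity)) hopen hK (hSW hcS) hmax ⟨h1, h2⟩⟩

/-- A holomorphic function on `ℂ \ {0}` with the quasi-periodicity of `thetaProd (x / b) Q`
that vanishes at `b` is a multiple of it. -/
lemma exists_eq_const_mul_thetaProd {Q b : ℂ} (hQ0 : Q ≠ 0) (hQ : ‖Q‖ < 1) (hb : b ≠ 0)
    {N : ℂ → ℂ} (hN : ∀ x, x ≠ 0 → DifferentiableAt ℂ N x)
    (hshift : ∀ x, x ≠ 0 → N (Q * x) = -(b / x) * N x) (hzero : N b = 0) :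
    ∃ C, ∀ y : ℂ, ‖Q‖ < ‖y‖ → ‖y‖ < ‖Q‖⁻¹ → N (b * y) = C * thetaProd y Q := by
  have hQp : 0 < ‖Q‖ := norm_pos_iff.2 hQ0
  set M : ℂ → ℂ := fun y => N (b * y) with hM
  set u : ℂ → ℂ := fun y => poch (y * Q) Q * poch (Q / y) Q * poch Q Q with hu
  have hne : ∀ y : ℂ, ‖Q‖ < ‖y‖ → y ≠ 0 := fun y hy => norm_pos_iff.1 (hQp.trans hy)
  have hpow : ∀ (a : ℂ) (n : ℕ), ‖a‖ < 1 → a * Q ^ n ≠ 1 := fun a n ha h => by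
    have := congrArg norm h
    rw [norm_mul, norm_pow, norm_one] at this
    have h2 := pow_le_one₀ (n := n) (norm_nonneg Q) hQ.le
    nlinarith [norm_nonneg a, pow_nonneg (norm_nonneg Q) n]
  have hu0 : ∀ y : ℂ, ‖Q‖ < ‖y‖ → ‖y‖ < ‖Q‖⁻¹ → u y ≠ 0 := by
    intro y h1 h2
    refine mul_ne_zero (mul_ne_zero (poch_ne_zero hQ fun n => hpow _ n ?_)
      (poch_ne_zero hQ fun n => hpow _ n ?_)) (poch_self_ne_zero hQ)
    · rw [norm_mul]
      calc ‖y‖ * ‖Q‖ < ‖Q‖⁻¹ * ‖Q‖ := by gcongr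
        _ = 1 := inv_mul_cancel₀ hQp.ne'
    · rw [norm_div]; exact (div_lt_one (hQp.trans h1)).2 h1
  have hMd : DifferentiableOn ℂ M {x : ℂ | ‖Q‖ < ‖x‖ ∧ ‖x‖ < ‖Q‖⁻¹} := fun y hy =>
    ((hN (b * y) (mul_ne_zero hb (hne y hy.1))).comp y
      (differentiableAt_id.const_mul b)).differentiableWithinAt
  have hopen : IsOpen {x : ℂ | ‖Q‖ < ‖x‖ ∧ ‖x‖ < ‖Q‖⁻¹} :=
    (isOpen_lt continuous_const continuous_norm).inter
      (isOpen_lt continuous_norm continuous_const)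
  have hM1 : M 1 = 0 := by simpa [hM] using hzero
  have hfac : ∀ y : ℂ, M y = (y - 1) * dslope M 1 y := fun y => by
    have := sub_smul_dslope M 1 y
    rw [hM1, sub_zero, smul_eq_mul] at this
    exact this.symm
  have hKM : ∀ y : ℂ, ‖Q‖ < ‖y‖ → ‖y‖ < ‖Q‖⁻¹ →
      M y = -dslope M 1 y / u y * thetaProd y Q := fun y h1 h2 => by
    have := hu0 y h1 h2
    rw [thetaProd_step hQ y, hfac y]
    change _ = _ * ((1 - y) * u y)
    field_simp
    ring
  have hKd : DifferentiableOn ℂ (fun y => -dslope M 1 y / u y)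
      {x : ℂ | ‖Q‖ < ‖x‖ ∧ ‖x‖ < ‖Q‖⁻¹} := by
    refine DifferentiableOn.div (((differentiableOn_dslope (hopen.mem_nhds ?_)).2 hMd).neg)
      (fun y hy => DifferentiableAt.differentiableWithinAt ?_) fun y hy => hu0 y hy.1 hy.2
    · simpa using ⟨hQ, (one_lt_inv₀ hQp).2 hQ⟩
    · have hy0 := hne y hy.1
      have h1 : DifferentiableAt ℂ (fun y => poch (y * Q) Q) y :=
        (differentiable_poch hQ (y * Q)).comp y (differentiableAt_id.mul_const Q)
      have h2 : DifferentiableAt ℂ (fun y => poch (Q / y) Q) y :=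
        (differentiable_poch hQ (Q / y)).comp y
          ((differentiableAt_const Q).div differentiableAt_id hy0)
      exact (h1.mul h2).mul_const _
  have hKinv : ∀ y : ℂ, 1 < ‖y‖ → ‖y‖ < ‖Q‖⁻¹ →
      -dslope M 1 (Q * y) / u (Q * y) = -dslope M 1 y / u y := by
    intro y h1 h2
    have hy0 : y ≠ 0 := norm_pos_iff.1 (by linarith)
    have hQy : ‖Q‖ < ‖Q * y‖ := by rw [norm_mul]; nlinarith
    have hQy2 : ‖Q * y‖ < ‖Q‖⁻¹ := by
      refine lt_trans ?_ ((one_lt_inv₀ hQp).2 hQ)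
      rw [norm_mul]
      calc ‖Q‖ * ‖y‖ < ‖Q‖ * ‖Q‖⁻¹ := by gcongr
        _ = 1 := mul_inv_cancel₀ hQp.ne'
    have e1 := hKM (Q * y) hQy hQy2
    have e2 := hKM y (hQ.trans h1) h2
    have e3 : M (Q * y) = -(1 / y) * M y := by
      have := hshift (b * y) (mul_ne_zero hb hy0)
      simp only [hM]
      rw [show b * (Q * y) = Q * (b * y) by ring, this]
      field_simp
    have ht : thetaProd y Q ≠ 0 := by
      rw [thetaProd_step hQ y]
      refine mul_ne_zero (sub_ne_zero.2 ?_) (hu0 y (hQ.trans h1) h2)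
      rintro rfl
      simp at h1
    rw [e3, e2, thetaProd_shift hQ0 hQ hy0] at e1
    have h4 : -(1 / y) * thetaProd y Q ≠ 0 := by simp [hy0, ht]
    refine mul_right_cancel₀ h4 ?_
    rw [← e1]; ring
  obtain ⟨c, hc⟩ := exists_const_of_mul_invariant hQ0 hQ hKd hKinv
  exact ⟨c, fun y h1 h2 => by rw [← hc y h1 h2]; exact hKM y h1 h2⟩

/-- The `k`-th term of the theta series `∑ (-1)^k P^(k²) z^k`. -/
noncomputable def thetaTerm (P z : ℂ) (k : ℤ) : ℂ := (-1) ^ k * P ^ (k ^ 2) * z ^ k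

/-- The theta series `∑ (-1)^k P^(k²) z^k`. -/
noncomputable def thetaSeries (P z : ℂ) : ℂ := ∑' k : ℤ, thetaTerm P z k

/-- The level two Appell–Lerch series `∑ (-1)^k P^(k²) z^k / (1 + x P^k)`. -/
noncomputable def appellSeries (P x z : ℂ) : ℂ := ∑' k : ℤ, thetaTerm P z k / (1 + x * P ^ k)

lemma summable_norm_thetaTerm_nat {P : ℂ} (hP0 : P ≠ 0) (hP : ‖P‖ < 1) {z : ℂ} (hz : z ≠ 0) :
    Summable fun n : ℕ => ‖thetaTerm P z n‖ := by
  have hne : ∀ n : ℕ, thetaTerm P z n ≠ 0 := fun n => by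
    simp [thetaTerm, zpow_ne_zero _ hP0, hz]
  refine summable_of_ratio_test_tendsto_lt_one zero_lt_one
    (.of_forall fun n => norm_ne_zero_iff.2 (hne n)) ?_
  have h : ∀ n : ℕ, ‖P‖ * ‖z‖ * (‖P‖ ^ 2) ^ n
      = ‖‖thetaTerm P z (n + 1 : ℕ)‖‖ / ‖‖thetaTerm P z n‖‖ := fun n => by
    have hPn := norm_ne_zero_iff.2 hP0
    have hzn := norm_ne_zero_iff.2 hz
    simp only [thetaTerm, norm_norm, norm_mul, norm_zpow, norm_neg, norm_one, one_zpow, one_mul]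
    norm_cast
    field_simp
    ring
  refine Tendsto.congr h ?_
  have h2 : ‖P‖ ^ 2 < 1 := pow_lt_one₀ (norm_nonneg _) hP two_ne_zero
  simpa using (tendsto_pow_atTop_nhds_zero_of_lt_one (by positivity) h2).const_mul (‖P‖ * ‖z‖)

lemma thetaTerm_neg (P z : ℂ) (k : ℤ) : thetaTerm P z (-k) = thetaTerm P z⁻¹ k := by
  simp only [thetaTerm, neg_sq, inv_zpow', zpow_neg]
  rw [← inv_zpow, show (-1 : ℂ)⁻¹ = -1 by norm_num]

lemma summable_norm_thetaTerm {P : ℂ} (hP0 : P ≠ 0) (hP : ‖P‖ < 1) {z : ℂ} (hz : z ≠ 0) :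
    Summable fun k : ℤ => ‖thetaTerm P z k‖ := by
  refine Summable.of_nat_of_neg (summable_norm_thetaTerm_nat hP0 hP hz) ?_
  simpa only [thetaTerm_neg] using summable_norm_thetaTerm_nat hP0 hP (inv_ne_zero hz)

lemma differentiableAt_thetaSeries {P : ℂ} (hP0 : P ≠ 0) (hP : ‖P‖ < 1) {z : ℂ} (hz : z ≠ 0) :
    DifferentiableAt ℂ (thetaSeries P) z := by
  have hzp : 0 < ‖z‖ := norm_pos_iff.2 hz
  set U : Set ℂ := {w : ℂ | ‖z‖ / 2 < ‖w‖ ∧ ‖w‖ < 2 * ‖z‖} with hU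
  have hopen : IsOpen U := (isOpen_lt continuous_const continuous_norm).inter
    (isOpen_lt continuous_norm continuous_const)
  have hd : DifferentiableOn ℂ (fun w => ∑' k : ℤ, thetaTerm P w k) U := by
    refine differentiableOn_tsum_of_summable_norm
      ((summable_norm_thetaTerm hP0 hP (z := 2 * z) (by simpa using hz)).add
        (summable_norm_thetaTerm hP0 hP (z := z / 2) (by simpa using hz)))
      (fun k w hw => ?_) hopen fun k w hw => ?_
    · have hw0 : w ≠ 0 := norm_pos_iff.1 (lt_trans (by positivity) hw.1)
      exact ((differentiableAt_zpow.2 (.inl hw0)).const_mul _).differentiableWithinAt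
    · simp only [thetaTerm, norm_mul, norm_zpow, norm_neg, norm_one, one_zpow, one_mul,
        ← mul_add, norm_div, RCLike.norm_ofNat]
      gcongr
      have hw0 : 0 < ‖w‖ := lt_trans (by positivity) hw.1
      rcases le_total 0 k with hk | hk
      · have := zpow_le_zpow_left₀ hk hw0.le hw.2.le
        have h2 : 0 ≤ (‖z‖ / 2) ^ k := by positivity
        linarith
      · obtain ⟨n, rfl⟩ := Int.exists_eq_neg_ofNat hk
        have h2 : 0 ≤ (2 * ‖z‖) ^ (-(n : ℤ)) := by positivity
        have : ‖w‖ ^ (-(n : ℤ)) ≤ (‖z‖ / 2) ^ (-(n : ℤ)) := by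
          rw [zpow_neg, zpow_neg, zpow_natCast, zpow_natCast]
          gcongr
          exact hw.1.le
        linarith
  exact hd.differentiableAt (hopen.mem_nhds ⟨by linarith, by linarith⟩)

lemma thetaSeries_inv (P z : ℂ) : thetaSeries P z⁻¹ = thetaSeries P z := by
  unfold thetaSeries
  rw [← (Equiv.neg ℤ).tsum_eq]
  exact tsum_congr fun k => by simpa using thetaTerm_neg P z⁻¹ k

lemma thetaTerm_add_one {P : ℂ} (hP0 : P ≠ 0) {z : ℂ} (hz : z ≠ 0) (k : ℤ) :
    thetaTerm P z (k + 1) = -(P * z) * thetaTerm P (P ^ 2 * z) k := by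
  simp only [thetaTerm, mul_zpow]
  rw [show (k + 1) ^ 2 = k ^ 2 + 2 * k + 1 by ring, zpow_add₀ hP0, zpow_add₀ hP0,
    zpow_add₀ hz, zpow_add₀ (by norm_num : (-1 : ℂ) ≠ 0), zpow_mul, zpow_one, zpow_one, zpow_one,
    zpow_ofNat P 2]
  ring

lemma thetaSeries_shift {P : ℂ} (hP0 : P ≠ 0) {z : ℂ} (hz : z ≠ 0) :
    thetaSeries P (P ^ 2 * z) = -(1 / (P * z)) * thetaSeries P z := by
  have : thetaSeries P z = -(P * z) * thetaSeries P (P ^ 2 * z) := by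
    unfold thetaSeries
    rw [← (Equiv.addRight (1 : ℤ)).tsum_eq, ← tsum_mul_left]
    exact tsum_congr fun k => by simpa using thetaTerm_add_one hP0 hz k
  rw [this]
  field_simp

lemma thetaSeries_self_eq_zero {P : ℂ} (hP0 : P ≠ 0) : thetaSeries P P⁻¹ = 0 := by
  have h := thetaSeries_shift hP0 (inv_ne_zero hP0)
  rw [show P ^ 2 * P⁻¹ = P by field_simp, mul_inv_cancel₀ hP0, thetaSeries_inv] at h
  rw [thetaSeries_inv]
  linear_combination h / 2

/-- The series form and the product form of the theta function are proportional. -/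
lemma exists_thetaSeries_eq_const_mul {P : ℂ} (hP0 : P ≠ 0) (hP : ‖P‖ < 1) :
    ∃ C, ∀ y : ℂ, ‖P ^ 2‖ < ‖y‖ → ‖y‖ < ‖P ^ 2‖⁻¹ →
      thetaSeries P (P⁻¹ * y) = C * thetaProd y (P ^ 2) := by
  refine exists_eq_const_mul_thetaProd (pow_ne_zero 2 hP0) ?_ (inv_ne_zero hP0)
    (fun x hx => differentiableAt_thetaSeries hP0 hP hx) (fun x hx => ?_)
    (thetaSeries_self_eq_zero hP0)
  · rw [norm_pow]; exact pow_lt_one₀ (norm_nonneg _) hP two_ne_zero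
  · rw [thetaSeries_shift hP0 hx]; field_simp

lemma exists_forall_ne_one_add_ne_zero {P : ℂ} (hP0 : P ≠ 0) (hP : ‖P‖ < 1) (x : ℂ) :
    ∃ k₀ : ℤ, ∀ k ≠ k₀, 1 + x * P ^ k ≠ 0 := by
  by_cases h : ∃ k₀ : ℤ, 1 + x * P ^ k₀ = 0
  · obtain ⟨k₀, hk₀⟩ := h
    refine ⟨k₀, fun k hk h => hk ?_⟩
    have hx : x ≠ 0 := by rintro rfl; simp at h
    have : P ^ k = P ^ k₀ := mul_left_cancel₀ hx (by linear_combination h - hk₀)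
    have hn := congrArg norm this
    rw [norm_zpow, norm_zpow] at hn
    exact zpow_right_injective₀ (norm_pos_iff.2 hP0) hP.ne hn
  · push Not at h
    exact ⟨0, fun k _ => h k⟩

lemma exists_le_norm_one_add {P : ℂ} (hP0 : P ≠ 0) (hP : ‖P‖ < 1) {x₀ : ℂ} (hx₀ : x₀ ≠ 0)
    {k₀ : ℤ} (hk₀ : ∀ k ≠ k₀, 1 + x₀ * P ^ k ≠ 0) :
    ∃ δ > 0, ∀ᶠ x in 𝓝 x₀, ∀ k ≠ k₀, δ ≤ ‖1 + x * P ^ k‖ := by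
  have hPp : 0 < ‖P‖ := norm_pos_iff.2 hP0
  have hxp : 0 < ‖x₀‖ := norm_pos_iff.2 hx₀
  have ht := tendsto_pow_atTop_nhds_zero_of_lt_one (norm_nonneg P) hP
  obtain ⟨m, hm⟩ := ((ht.eventually_le_const (u := (4 * ‖x₀‖)⁻¹) (by positivity)).and
    (ht.eventually_le_const (u := ‖x₀‖ / 4) (by positivity))).exists
  set S : Finset ℤ := (Finset.Ioo (-(m : ℤ)) m).filter (· ≠ k₀) with hS
  obtain ⟨δ, hδS, hδ0, hδ1⟩ : ∃ δ : ℝ, (∀ k ∈ S, δ < ‖1 + x₀ * P ^ k‖) ∧ 0 < δ ∧ δ < 1 / 2 := by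
    have h1 : ∀ᶠ δ : ℝ in 𝓝[>] 0, ∀ k ∈ S, δ < ‖1 + x₀ * P ^ k‖ := by
      refine (Filter.eventually_all_finset S).2 fun k hk => ?_
      exact nhdsWithin_le_nhds
        (eventually_lt_nhds (norm_pos_iff.2 (hk₀ k (Finset.mem_filter.1 hk).2)))
    have h2 : ∀ᶠ δ : ℝ in 𝓝[>] 0, δ < 1 / 2 :=
      nhdsWithin_le_nhds (eventually_lt_nhds (by norm_num))
    obtain ⟨δ, h⟩ := (h1.and (h2.and self_mem_nhdsWithin)).exists
    exact ⟨δ, h.1, h.2.2, h.2.1⟩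
  refine ⟨δ, hδ0, ?_⟩
  have hfin : ∀ᶠ x in 𝓝 x₀, ∀ k ∈ S, δ < ‖1 + x * P ^ k‖ :=
    (Filter.eventually_all_finset S).2 fun k hk =>
      (by fun_prop : Continuous fun x => ‖1 + x * P ^ k‖).continuousAt.eventually
        (lt_mem_nhds (hδS k hk))
  have hlo : ∀ᶠ x in 𝓝 x₀, ‖x₀‖ / 2 < ‖x‖ :=
    continuous_norm.continuousAt.eventually (lt_mem_nhds (by linarith))
  have hhi : ∀ᶠ x in 𝓝 x₀, ‖x‖ < 2 * ‖x₀‖ :=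
    continuous_norm.continuousAt.eventually (gt_mem_nhds (by linarith))
  filter_upwards [hfin, hlo, hhi] with x h1 h2 h3 k hk
  by_cases hkS : k ∈ Finset.Ioo (-(m : ℤ)) m
  · exact (h1 k (Finset.mem_filter.2 ⟨hkS, hk⟩)).le
  rw [Finset.mem_Ioo, not_and_or, not_lt, not_lt] at hkS
  refine hδ1.le.trans ?_
  rcases hkS with h | h
  · have hle : (‖P‖ ^ m)⁻¹ ≤ ‖P‖ ^ k := by
      rw [← zpow_natCast, ← zpow_neg]
      exact zpow_le_zpow_right_of_le_one₀ hPp hP.le h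
    have h4 : 4 / ‖x₀‖ ≤ (‖P‖ ^ m)⁻¹ := by
      rw [← inv_div]; exact inv_anti₀ (by positivity) hm.2
    have h5 : 2 ≤ ‖x * P ^ k‖ := by
      rw [norm_mul, norm_zpow]
      calc (2 : ℝ) = ‖x₀‖ / 2 * (4 / ‖x₀‖) := by field_simp; norm_num
        _ ≤ ‖x‖ * ‖P‖ ^ k := by gcongr; exact h4.trans hle
    have := norm_sub_norm_le (x * P ^ k) (-1)
    rw [norm_neg, norm_one, sub_neg_eq_add, add_comm (x * P ^ k)] at this
    linarith
  · have hle : ‖P‖ ^ k ≤ ‖P‖ ^ m := by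
      rw [← zpow_natCast]
      exact zpow_le_zpow_right_of_le_one₀ hPp hP.le h
    have h5 : ‖x * P ^ k‖ ≤ 1 / 2 := by
      rw [norm_mul, norm_zpow]
      calc ‖x‖ * ‖P‖ ^ k ≤ 2 * ‖x₀‖ * (4 * ‖x₀‖)⁻¹ := by gcongr; exact hle.trans hm.1
        _ = 1 / 2 := by field_simp; norm_num
    have := norm_sub_norm_le (1 : ℂ) (-(x * P ^ k))
    rw [norm_neg, norm_one, sub_neg_eq_add] at this
    linarith

lemma summable_appellSeries {P : ℂ} (hP0 : P ≠ 0) (hP : ‖P‖ < 1) {x z : ℂ} (hx : x ≠ 0)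
    (hz : z ≠ 0) : Summable fun k : ℤ => thetaTerm P z k / (1 + x * P ^ k) := by
  obtain ⟨k₀, hk₀⟩ := exists_forall_ne_one_add_ne_zero hP0 hP x
  obtain ⟨δ, hδ, h⟩ := exists_le_norm_one_add hP0 hP hx hk₀
  refine Summable.of_norm_bounded_eventually
    ((summable_norm_thetaTerm hP0 hP hz).mul_right δ⁻¹) ?_
  filter_upwards [(Set.finite_singleton k₀).compl_mem_cofinite] with k hk
  rw [norm_div, div_eq_mul_inv]
  gcongr
  exact h.self_of_nhds k hk

/-- Near a nonzero point the Appell–Lerch series is a holomorphic function plus the term that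
may have a pole there. -/
lemma exists_appellSeries_eq_add_analytic {P : ℂ} (hP0 : P ≠ 0) (hP : ‖P‖ < 1) {x₀ z : ℂ}
    (hx₀ : x₀ ≠ 0) (hz : z ≠ 0) {k₀ : ℤ} (hk₀ : ∀ k ≠ k₀, 1 + x₀ * P ^ k ≠ 0) :
    ∃ R : ℂ → ℂ, AnalyticAt ℂ R x₀ ∧
      ∀ᶠ x in 𝓝 x₀, appellSeries P x z = thetaTerm P z k₀ / (1 + x * P ^ k₀) + R x := by
  obtain ⟨δ, hδ, h⟩ := exists_le_norm_one_add hP0 hP hx₀ hk₀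
  refine ⟨fun x => ∑' k : ℤ, if k = k₀ then 0 else thetaTerm P z k / (1 + x * P ^ k), ?_, ?_⟩
  · obtain ⟨U, hU, hUo, hxU⟩ := eventually_nhds_iff.1 h
    refine DifferentiableOn.analyticAt (s := U) ?_ (hUo.mem_nhds hxU)
    refine differentiableOn_tsum_of_summable_norm
      ((summable_norm_thetaTerm hP0 hP hz).mul_right δ⁻¹) (fun k x hx => ?_) hUo
      fun k x hx => ?_
    · by_cases hk : k = k₀
      · simpa only [hk, if_true] using differentiableWithinAt_const 0
      · simp only [hk, if_false]
        have : 1 + x * P ^ k ≠ 0 := norm_pos_iff.1 (hδ.trans_le (hU x hx k hk))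
        have hden : DifferentiableAt ℂ (fun x : ℂ => 1 + x * P ^ k) x := by fun_prop
        exact ((differentiableAt_const _).div hden this).differentiableWithinAt
    · by_cases hk : k = k₀
      · simp only [hk, if_true, norm_zero]; positivity
      · rw [if_neg hk, norm_div, div_eq_mul_inv]
        gcongr
        exact hU x hx k hk
  · filter_upwards [isOpen_ne.mem_nhds hx₀] with x hx
    exact (summable_appellSeries hP0 hP hx hz).tsum_eq_add_tsum_ite k₀

lemma analyticAt_appellSeries {P : ℂ} (hP0 : P ≠ 0) (hP : ‖P‖ < 1) {x₀ z : ℂ}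
    (hx₀ : x₀ ≠ 0) (hz : z ≠ 0) (h : ∀ k : ℤ, 1 + x₀ * P ^ k ≠ 0) :
    AnalyticAt ℂ (fun x => appellSeries P x z) x₀ := by
  obtain ⟨R, hR, hRe⟩ := exists_appellSeries_eq_add_analytic hP0 hP hx₀ hz (k₀ := 0)
    fun k _ => h k
  refine AnalyticAt.congr ?_ (hRe.mono fun x hx => hx.symm)
  have hden : AnalyticAt ℂ (fun x : ℂ => 1 + x * P ^ (0 : ℤ)) x₀ :=
    analyticAt_const.add (analyticAt_id.mul analyticAt_const)
  exact (analyticAt_const.div hden (h 0)).add hR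

lemma appellSeries_add {P : ℂ} (hP0 : P ≠ 0) (hP : ‖P‖ < 1) {x z : ℂ} (hx : x ≠ 0)
    (hz : z ≠ 0) (h : ∀ k : ℤ, 1 + x * P ^ k ≠ 0) :
    appellSeries P x z + x * appellSeries P x (z * P) = thetaSeries P z := by
  unfold appellSeries thetaSeries
  rw [← tsum_mul_left, ← (summable_appellSeries hP0 hP hx hz).tsum_add
    ((summable_appellSeries hP0 hP hx (mul_ne_zero hz hP0)).mul_left x)]
  refine tsum_congr fun k => ?_
  have := h k
  simp only [thetaTerm, mul_zpow]
  field_simp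

lemma appellSeries_inv (P x z : ℂ) (hP0 : P ≠ 0) (hx : x ≠ 0) :
    appellSeries P x z = x⁻¹ * appellSeries P x⁻¹ (P / z) := by
  unfold appellSeries
  rw [← (Equiv.neg ℤ).tsum_eq, ← tsum_mul_left]
  refine tsum_congr fun k => ?_
  have hk : P ^ k ≠ 0 := zpow_ne_zero _ hP0
  have hden : 1 + x * P ^ (-k) = x * (P ^ k)⁻¹ * (1 + x⁻¹ * P ^ k) := by
    rw [zpow_neg]; field_simp; ring
  rw [Equiv.neg_apply, thetaTerm_neg, hden, div_eq_mul_inv, div_eq_mul_inv, mul_inv, mul_inv,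
    inv_inv]
  simp only [thetaTerm, div_zpow, inv_zpow]
  ring

lemma appellSeries_mul {P x z : ℂ} (hP0 : P ≠ 0) (hz : z ≠ 0) :
    appellSeries P (x * P) z = -(P / z) * appellSeries P x (z / P ^ 2) := by
  unfold appellSeries
  rw [← (Equiv.addRight (1 : ℤ)).tsum_eq (fun k => thetaTerm P (z / P ^ 2) k / (1 + x * P ^ k)),
    ← tsum_mul_left]
  refine tsum_congr fun k => ?_
  have hz2 : z / P ^ 2 ≠ 0 := div_ne_zero hz (pow_ne_zero 2 hP0)
  rw [Equiv.coe_addRight, thetaTerm_add_one hP0 hz2, mul_div_cancel₀ _ (pow_ne_zero 2 hP0),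
    zpow_add_one₀ hP0, mul_assoc x P, mul_comm P, ← mul_div_assoc]
  congr 1
  field_simp

lemma appellSeries_shift {P x z : ℂ} (hP0 : P ≠ 0) (hP : ‖P‖ < 1) (hx : x ≠ 0) (hz : z ≠ 0)
    (h : ∀ k : ℤ, 1 + x * P ^ k ≠ 0) :
    appellSeries P (x * P) z
      = thetaSeries P z - P / z * x ^ 2 * appellSeries P x z - P * x * thetaSeries P (z * P) := by
  have h1 := appellSeries_add hP0 hP hx (div_ne_zero hz (pow_ne_zero 2 hP0)) h
  have h2 := appellSeries_add hP0 hP hx (div_ne_zero hz hP0) h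
  have h3 := thetaSeries_shift hP0 (div_ne_zero hz (pow_ne_zero 2 hP0))
  have h4 := thetaSeries_shift hP0 (div_ne_zero hz hP0)
  rw [show z / P ^ 2 * P = z / P by field_simp] at h1
  rw [show z / P * P = z by field_simp] at h2
  rw [show P ^ 2 * (z / P ^ 2) = z by field_simp] at h3
  rw [show P ^ 2 * (z / P) = z * P by field_simp] at h4
  rw [appellSeries_mul hP0 hz, h4, h3, ← h2, ← h1]
  field_simp
  ring

lemma exists_analytic_extension {N : ℂ → ℂ}
    (h : ∀ x, x ≠ 0 → ∃ A : ℂ → ℂ, AnalyticAt ℂ A x ∧ N =ᶠ[𝓝[≠] x] A) :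
    ∃ M : ℂ → ℂ, ∀ x, x ≠ 0 → AnalyticAt ℂ M x ∧ N =ᶠ[𝓝[≠] x] M := by
  choose! A hA hNA using h
  refine ⟨fun x => A x x, fun x₀ hx₀ => ?_⟩
  have hev : ∀ᶠ y in 𝓝[≠] x₀, A y y = A x₀ y := by
    have h1 := eventually_eventually_nhdsWithin.2 (hNA x₀ hx₀)
    filter_upwards [h1, self_mem_nhdsWithin,
      nhdsWithin_le_nhds (hA x₀ hx₀).eventually_analyticAt,
      nhdsWithin_le_nhds (isOpen_ne.mem_nhds hx₀)] with y hy hyx hyA hy0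
    rw [IsOpen.nhdsWithin_eq isOpen_compl_singleton hyx] at hy
    have h2 : A y =ᶠ[𝓝[≠] y] A x₀ := (hNA y hy0).symm.trans (nhdsWithin_le_nhds hy)
    exact (((hA y hy0).continuousAt.eventuallyEq_nhds_iff_eventuallyEq_nhdsNE
      hyA.continuousAt).1 h2).eq_of_nhds
  refine ⟨(hA x₀ hx₀).congr ?_, (hNA x₀ hx₀).trans (hev.mono fun y hy => hy.symm)⟩
  rw [eventually_nhdsWithin_iff] at hev
  filter_upwards [hev] with y hy
  by_cases hyx : y = x₀
  · rw [hyx]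
  · exact (hy hyx).symm

lemma analyticAt_thetaProd {Q : ℂ} (hQ : ‖Q‖ < 1) {y : ℂ} (hy : y ≠ 0) :
    AnalyticAt ℂ (fun y => thetaProd y Q) y :=
  DifferentiableOn.analyticAt (s := {0}ᶜ)
    (fun _ hx => (differentiableAt_thetaProd hQ hx).differentiableWithinAt)
    (isOpen_compl_singleton.mem_nhds hy)

lemma analyticAt_thetaProd_mul {Q : ℂ} (hQ : ‖Q‖ < 1) {a x : ℂ} (ha : a ≠ 0) (hx : x ≠ 0) :
    AnalyticAt ℂ (fun x => thetaProd (a * x) Q) x :=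
  (analyticAt_thetaProd hQ (mul_ne_zero ha hx)).fun_comp
    (analyticAt_const.mul analyticAt_id : AnalyticAt ℂ (fun x => a * x) x)

/-- The theta product cancels the poles of the Appell–Lerch series. -/
lemma exists_appellSeries_mul_thetaProd_analytic {P : ℂ} (hP0 : P ≠ 0) (hP : ‖P‖ < 1)
    {x₀ z : ℂ} (hx₀ : x₀ ≠ 0) (hz : z ≠ 0) :
    ∃ A : ℂ → ℂ, AnalyticAt ℂ A x₀ ∧
      (fun x => appellSeries P x z * thetaProd (-x) P) =ᶠ[𝓝[≠] x₀] A := by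
  obtain ⟨k₀, hk₀⟩ := exists_forall_ne_one_add_ne_zero hP0 hP x₀
  obtain ⟨R, hR, hRe⟩ := exists_appellSeries_eq_add_analytic hP0 hP hx₀ hz hk₀
  have hj : AnalyticAt ℂ (fun x => thetaProd (-x) P) x₀ := by
    simpa using analyticAt_thetaProd_mul hP (a := -1) (by norm_num) hx₀
  by_cases h : 1 + x₀ * P ^ k₀ = 0
  · have hj0 : thetaProd (-x₀) P = 0 :=
      thetaProd_eq_zero hP0 (k := k₀) (by linear_combination -h)
    have hds : AnalyticAt ℂ (dslope (fun x => thetaProd (-x) P) x₀) x₀ := by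
      obtain ⟨U, hU, hUo, hxU⟩ := eventually_nhds_iff.1 hj.eventually_analyticAt
      exact ((differentiableOn_dslope (hUo.mem_nhds hxU)).2 fun x hx =>
        (hU x hx).differentiableAt.differentiableWithinAt).analyticAt (hUo.mem_nhds hxU)
    refine ⟨fun x => thetaTerm P z k₀ * (P ^ k₀)⁻¹ * dslope (fun x => thetaProd (-x) P) x₀ x
      + R x * thetaProd (-x) P, (analyticAt_const.mul hds).add (hR.mul hj), ?_⟩
    filter_upwards [nhdsWithin_le_nhds hRe, self_mem_nhdsWithin] with x hx hne
    have hsub : x - x₀ ≠ 0 := sub_ne_zero.2 hne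
    have hk : P ^ k₀ ≠ 0 := zpow_ne_zero _ hP0
    have e1 : thetaProd (-x) P = (x - x₀) * dslope (fun x => thetaProd (-x) P) x₀ x := by
      have := sub_smul_dslope (fun x => thetaProd (-x) P) x₀ x
      simp only [hj0, sub_zero, smul_eq_mul] at this
      exact this.symm
    have e2 : 1 + x * P ^ k₀ = (x - x₀) * P ^ k₀ := by linear_combination h
    rw [hx, add_mul, e2]
    congr 1
    rw [e1]
    field_simp
  · refine ⟨fun x => (thetaTerm P z k₀ / (1 + x * P ^ k₀) + R x) * thetaProd (-x) P, ?_, ?_⟩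
    · have hden : AnalyticAt ℂ (fun x : ℂ => 1 + x * P ^ k₀) x₀ :=
        analyticAt_const.add (analyticAt_id.mul analyticAt_const)
      exact ((analyticAt_const.div hden h).add hR).mul hj
    · filter_upwards [nhdsWithin_le_nhds hRe] with x hx
      rw [hx]

lemma tendsto_const_mul_nhdsNE {a : ℂ} (ha : a ≠ 0) (x : ℂ) :
    Tendsto (fun y => a * y) (𝓝[≠] x) (𝓝[≠] (a * x)) :=
  tendsto_nhdsWithin_of_tendsto_nhds_of_eventually_within _
    ((continuous_const_mul a).continuousAt.tendsto.mono_left nhdsWithin_le_nhds)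
    (eventually_nhdsWithin_of_forall fun _ hy h => hy (mul_left_cancel₀ ha h))

lemma exists_appellSeries_mul_thetaProd_analytic' {P : ℂ} (hP0 : P ≠ 0) (hP : ‖P‖ < 1)
    {a x₀ z : ℂ} (ha : a ≠ 0) (hx₀ : x₀ ≠ 0) (hz : z ≠ 0) :
    ∃ A : ℂ → ℂ, AnalyticAt ℂ A x₀ ∧
      (fun x => appellSeries P (a * x) z * thetaProd (-(a * x)) P) =ᶠ[𝓝[≠] x₀] A := by
  obtain ⟨A, hA, he⟩ := exists_appellSeries_mul_thetaProd_analytic hP0 hP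
    (mul_ne_zero ha hx₀) hz
  exact ⟨fun x => A (a * x),
    hA.fun_comp (analyticAt_const.mul analyticAt_id : AnalyticAt ℂ (fun x => a * x) x₀),
    (tendsto_const_mul_nhdsNE ha x₀).eventually he⟩

lemma eventually_one_add_ne_zero {p x₀ : ℂ} (hp0 : p ≠ 0) (hp : ‖p‖ < 1) (hx₀ : x₀ ≠ 0) :
    ∀ᶠ x in 𝓝[≠] x₀, ∀ k : ℤ, 1 + x * p ^ k ≠ 0 := by
  obtain ⟨k₀, hk₀⟩ := exists_forall_ne_one_add_ne_zero hp0 hp x₀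
  obtain ⟨δ, hδ, h⟩ := exists_le_norm_one_add hp0 hp hx₀ hk₀
  have hone : ∀ᶠ x in 𝓝[≠] x₀, 1 + x * p ^ k₀ ≠ 0 := by
    have hk : p ^ k₀ ≠ 0 := zpow_ne_zero _ hp0
    by_cases h0 : 1 + x₀ * p ^ k₀ = 0
    · filter_upwards [self_mem_nhdsWithin] with x hx hx0
      exact hx (mul_right_cancel₀ hk (by linear_combination hx0 - h0))
    · have hc : ContinuousAt (fun x : ℂ => 1 + x * p ^ k₀) x₀ := by fun_prop
      exact nhdsWithin_le_nhds (hc.eventually_ne h0)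
  filter_upwards [nhdsWithin_le_nhds h, hone] with x hx hx1 k
  by_cases hk : k = k₀
  · rwa [hk]
  · exact norm_pos_iff.1 (hδ.trans_le (hx k hk))

lemma one_add_zpow_mul_ne_zero {p x : ℂ} (hp0 : p ≠ 0) (h : ∀ k : ℤ, 1 + x * p ^ k ≠ 0) (j k : ℤ) :
    1 + p ^ j * x * (p ^ 3) ^ k ≠ 0 := by
  have := h (j + 3 * k)
  rwa [zpow_add₀ hp0, zpow_mul, ← mul_assoc, mul_comm x] at this

/-- The combination of three Appell–Lerch series to base `p ^ 3` whose value at `1` is the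
identity to be proved. -/
noncomputable def appellCombination (p x : ℂ) : ℂ :=
  thetaSeries (p ^ 3) 1 * (appellSeries (p ^ 3) x p - appellSeries (p ^ 3) (p⁻¹ * x) p⁻¹)
    - 2 * p * thetaSeries (p ^ 3) (p ^ 2) * appellSeries (p ^ 3) (p * x) (p ^ 3)

lemma thetaSeries_cube_shift {p z : ℂ} (hp0 : p ≠ 0) (hz : z ≠ 0) :
    thetaSeries (p ^ 3) (p ^ 6 * z) = -(1 / (p ^ 3 * z)) * thetaSeries (p ^ 3) z := by
  rw [← thetaSeries_shift (pow_ne_zero 3 hp0) hz, ← pow_mul]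

lemma thetaSeries_cube_self {p : ℂ} (hp0 : p ≠ 0) : thetaSeries (p ^ 3) (p ^ 3) = 0 := by
  rw [← thetaSeries_inv, thetaSeries_self_eq_zero (pow_ne_zero 3 hp0)]

lemma thetaSeries_cube_pow_four {p : ℂ} (hp0 : p ≠ 0) :
    thetaSeries (p ^ 3) (p ^ 4) = -p⁻¹ * thetaSeries (p ^ 3) (p ^ 2) := by
  have h := thetaSeries_cube_shift hp0 (inv_ne_zero (pow_ne_zero 2 hp0))
  rw [thetaSeries_inv, show p ^ 6 * (p ^ 2)⁻¹ = p ^ 4 by field_simp] at h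
  rw [h]
  field_simp

lemma norm_pow_three_lt {p : ℂ} (hp : ‖p‖ < 1) : ‖p ^ 3‖ < 1 := by
  rw [norm_pow]
  exact pow_lt_one₀ (norm_nonneg p) hp (by norm_num)

lemma appellCombination_shift {p x : ℂ} (hp0 : p ≠ 0) (hp : ‖p‖ < 1) (hx : x ≠ 0)
    (h : ∀ k : ℤ, 1 + x * p ^ k ≠ 0) :
    appellCombination p (p ^ 3 * x) = -(p ^ 2 * x ^ 2) * appellCombination p x := by
  have hP0 := pow_ne_zero 3 hp0
  have hP := norm_pow_three_lt hp
  have h1 := appellSeries_shift hP0 hP hx hp0 (by simpa using one_add_zpow_mul_ne_zero hp0 h 0)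
  have h2 := appellSeries_shift hP0 hP (mul_ne_zero (inv_ne_zero hp0) hx) (inv_ne_zero hp0)
    (by simpa using one_add_zpow_mul_ne_zero hp0 h (-1))
  have h3 := appellSeries_shift hP0 hP (mul_ne_zero hp0 hx) hP0
    (by simpa using one_add_zpow_mul_ne_zero hp0 h 1)
  have t1 := thetaSeries_cube_shift hp0 one_ne_zero
  rw [mul_one] at t1
  rw [← pow_add, t1, thetaSeries_cube_self hp0] at h3
  rw [show p⁻¹ * p ^ 3 = p ^ 2 by field_simp, thetaSeries_inv] at h2
  rw [show p * p ^ 3 = p ^ 4 by ring, thetaSeries_cube_pow_four hp0] at h1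
  unfold appellCombination
  rw [show p ^ 3 * x = x * p ^ 3 by ring, show p⁻¹ * (x * p ^ 3) = p⁻¹ * x * p ^ 3 by ring,
    show p * (x * p ^ 3) = p * x * p ^ 3 by ring, h1, h2, h3]
  field_simp
  ring

lemma one_add_zpow_mul_zpow_ne_zero {p : ℂ} (hp0 : p ≠ 0) (hden : ∀ k : ℤ, p ^ k ≠ -1) (j k : ℤ) :
    1 + p ^ j * p ^ k ≠ 0 := by
  rw [← zpow_add₀ hp0]
  exact fun h => hden (j + k) (by linear_combination h)

lemma appellCombination_inv_eq_zero {p : ℂ} (hp0 : p ≠ 0) (hp : ‖p‖ < 1)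
    (hden : ∀ k : ℤ, p ^ k ≠ -1) : appellCombination p p⁻¹ = 0 := by
  have hP0 := pow_ne_zero 3 hp0
  have hP := norm_pow_three_lt hp
  have hg : ∀ j k : ℤ, 1 + p ^ j * (p ^ 3) ^ k ≠ 0 := fun j k => by
    simpa using one_add_zpow_mul_ne_zero hp0
      (x := 1) (fun k => by simpa using one_add_zpow_mul_zpow_ne_zero hp0 hden 0 k) j k
  have hg0 : ∀ k : ℤ, 1 + (1 : ℂ) * (p ^ 3) ^ k ≠ 0 := by simpa using hg 0
  have hg1 : ∀ k : ℤ, 1 + p⁻¹ * (p ^ 3) ^ k ≠ 0 := by simpa using hg (-1)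
  have a1 := appellSeries_add hP0 hP one_ne_zero one_ne_zero hg0
  have a2 := appellSeries_inv (p ^ 3) 1 1 hP0 one_ne_zero
  have b1 := appellSeries_inv (p ^ 3) (p⁻¹ * p⁻¹) p⁻¹ hP0 (by positivity)
  have b2 := appellSeries_shift hP0 hP (inv_ne_zero hp0) (pow_ne_zero 4 hp0) hg1
  have b3 := appellSeries_add hP0 hP (inv_ne_zero hp0) hp0 hg1
  have t := thetaSeries_cube_shift hp0 hp0
  simp only [one_mul, inv_one, div_one] at a1 a2
  rw [thetaSeries_cube_pow_four hp0, show p ^ 4 * p ^ 3 = p ^ 6 * p by ring, t,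
    show p⁻¹ * p ^ 3 = p ^ 2 by field_simp] at b2
  rw [show (p⁻¹ * p⁻¹)⁻¹ = p ^ 2 by field_simp, show p ^ 3 / p⁻¹ = p ^ 4 by field_simp, b2] at b1
  rw [show p * p ^ 3 = p ^ 4 by ring] at b3
  have b3' : appellSeries (p ^ 3) p⁻¹ (p ^ 4)
      = p * (thetaSeries (p ^ 3) p - appellSeries (p ^ 3) p⁻¹ p) := by
    rw [← b3]; field_simp; ring
  have a3 : appellSeries (p ^ 3) 1 (p ^ 3) = thetaSeries (p ^ 3) 1 / 2 := by
    rw [← a1, a2]; ring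
  unfold appellCombination
  rw [mul_inv_cancel₀ hp0, a3, b1, b3']
  field_simp
  ring

lemma appellCombination_sq_eq_zero {p : ℂ} (hp0 : p ≠ 0) (hp : ‖p‖ < 1)
    (hden : ∀ k : ℤ, p ^ k ≠ -1) : appellCombination p (p ^ 2) = 0 := by
  have h := appellCombination_shift hp0 hp (inv_ne_zero hp0)
    (by simpa using one_add_zpow_mul_zpow_ne_zero hp0 hden (-1))
  rwa [appellCombination_inv_eq_zero hp0 hp hden, mul_zero,
    show p ^ 3 * p⁻¹ = p ^ 2 by field_simp] at h

lemma zpow_ne_one_of_norm_lt_one {p : ℂ} (hp : ‖p‖ < 1) {k : ℤ} (hk : k ≠ 0) :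
    p ^ k ≠ 1 := by
  intro h
  have h1 : ‖p‖ ^ k = 1 := by rw [← norm_zpow, h, norm_one]
  rw [zpow_eq_one_iff_right₀ (norm_nonneg p) hp.ne] at h1
  exact hk h1

lemma appellSeries_mul_thetaProd_neg_one {P z : ℂ} (hP0 : P ≠ 0) (hP : ‖P‖ < 1) (hz : z ≠ 0) :
    Tendsto (fun x => appellSeries P x z * thetaProd (-x) P) (𝓝[≠] (-1)) (𝓝 (poch P P ^ 3)) := by
  have hk : ∀ k : ℤ, k ≠ 0 → 1 + -1 * P ^ k ≠ 0 := fun k hk h =>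
    zpow_ne_one_of_norm_lt_one hP hk (by linear_combination -h)
  obtain ⟨R, hR, hRe⟩ := exists_appellSeries_eq_add_analytic hP0 hP
    (by norm_num : (-1 : ℂ) ≠ 0) hz hk
  have hpoch := (differentiable_poch hP).continuous
  have hu : ContinuousAt (fun x => poch (-x * P) P * poch (P / -x) P * poch P P
      + R x * thetaProd (-x) P) (-1) := by
    refine ContinuousAt.add (ContinuousAt.mul (ContinuousAt.mul ?_ ?_) continuousAt_const)
      (hR.continuousAt.mul ?_)
    · exact (hpoch.comp (by fun_prop : Continuous fun x : ℂ => -x * P)).continuousAt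
    · exact hpoch.continuousAt.comp
        (ContinuousAt.div continuousAt_const continuousAt_neg (by norm_num))
    · simpa using (analyticAt_thetaProd_mul hP (a := -1) (x := -1) (by norm_num)
        (by norm_num)).continuousAt
  have hj : thetaProd 1 P = 0 := thetaProd_eq_zero hP0 (k := 0) (by simp)
  have hlim := hu.tendsto.mono_left (nhdsWithin_le_nhds (s := {(-1 : ℂ)}ᶜ))
  simp only [neg_neg, one_mul, div_one, hj, mul_zero, add_zero] at hlim
  rw [pow_three, ← mul_assoc]
  refine hlim.congr' ?_
  filter_upwards [nhdsWithin_le_nhds hRe, self_mem_nhdsWithin] with x hx hne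
  have h1 : 1 + x ≠ 0 := fun h => hne (by rw [Set.mem_singleton_iff]; linear_combination h)
  rw [hx, add_mul, thetaProd_step hP (-x)]
  simp only [thetaTerm, zpow_zero, mul_one, ne_eq, OfNat.ofNat_ne_zero, not_false_eq_true,
    zero_pow, sub_neg_eq_add]
  field_simp

/-- `appellCombination` with its poles cleared. -/
noncomputable def clearedCombination (p x : ℂ) : ℂ :=
  appellCombination p x * (thetaProd (-x) (p ^ 3) * thetaProd (-(p⁻¹ * x)) (p ^ 3)
    * thetaProd (-(p * x)) (p ^ 3))

lemma clearedCombination_eq (p x : ℂ) : clearedCombination p x =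
    thetaSeries (p ^ 3) 1 * (appellSeries (p ^ 3) x p * thetaProd (-x) (p ^ 3))
        * (thetaProd (-(p⁻¹ * x)) (p ^ 3) * thetaProd (-(p * x)) (p ^ 3))
      - thetaSeries (p ^ 3) 1
        * (appellSeries (p ^ 3) (p⁻¹ * x) p⁻¹ * thetaProd (-(p⁻¹ * x)) (p ^ 3))
        * (thetaProd (-x) (p ^ 3) * thetaProd (-(p * x)) (p ^ 3))
      - 2 * p * thetaSeries (p ^ 3) (p ^ 2)
        * (appellSeries (p ^ 3) (p * x) (p ^ 3) * thetaProd (-(p * x)) (p ^ 3))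
        * (thetaProd (-x) (p ^ 3) * thetaProd (-(p⁻¹ * x)) (p ^ 3)) := by
  unfold clearedCombination appellCombination
  ring

lemma clearedCombination_shift {p x : ℂ} (hp0 : p ≠ 0) (hp : ‖p‖ < 1) (hx : x ≠ 0)
    (h : ∀ k : ℤ, 1 + x * p ^ k ≠ 0) :
    clearedCombination p (p ^ 3 * x) = -(p ^ 2 / x) * clearedCombination p x := by
  have hP0 := pow_ne_zero 3 hp0
  have hP := norm_pow_three_lt hp
  have s1 := thetaProd_shift hP0 hP (neg_ne_zero.2 hx)
  have s2 := thetaProd_shift hP0 hP (neg_ne_zero.2 (mul_ne_zero (inv_ne_zero hp0) hx))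
  have s3 := thetaProd_shift hP0 hP (neg_ne_zero.2 (mul_ne_zero hp0 hx))
  unfold clearedCombination
  rw [appellCombination_shift hp0 hp hx h, show -(p ^ 3 * x) = p ^ 3 * -x by ring,
    show -(p⁻¹ * (p ^ 3 * x)) = p ^ 3 * -(p⁻¹ * x) by ring,
    show -(p * (p ^ 3 * x)) = p ^ 3 * -(p * x) by ring, s1, s2, s3]
  field_simp

lemma analyticAt_thetaProd_neg_mul {Q : ℂ} (hQ : ‖Q‖ < 1) {a x : ℂ} (ha : a ≠ 0) (hx : x ≠ 0) :
    AnalyticAt ℂ (fun x => thetaProd (-(a * x)) Q) x := by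
  simpa using analyticAt_thetaProd_mul hQ (neg_ne_zero.2 ha) hx

lemma analyticAt_appellSeries_mul {P : ℂ} (hP0 : P ≠ 0) (hP : ‖P‖ < 1) {a x₀ z : ℂ} (ha : a ≠ 0)
    (hx₀ : x₀ ≠ 0) (hz : z ≠ 0) (h : ∀ k : ℤ, 1 + a * x₀ * P ^ k ≠ 0) :
    AnalyticAt ℂ (fun x => appellSeries P (a * x) z) x₀ :=
  (analyticAt_appellSeries hP0 hP (mul_ne_zero ha hx₀) hz h).fun_comp
    (analyticAt_const.mul analyticAt_id : AnalyticAt ℂ (fun x => a * x) x₀)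

lemma exists_clearedCombination_analytic {p x₀ : ℂ} (hp0 : p ≠ 0) (hp : ‖p‖ < 1) (hx₀ : x₀ ≠ 0) :
    ∃ A : ℂ → ℂ, AnalyticAt ℂ A x₀ ∧ clearedCombination p =ᶠ[𝓝[≠] x₀] A := by
  have hP0 := pow_ne_zero 3 hp0
  have hP := norm_pow_three_lt hp
  obtain ⟨A₁, h₁, e₁⟩ := exists_appellSeries_mul_thetaProd_analytic hP0 hP hx₀ hp0
  obtain ⟨A₂, h₂, e₂⟩ := exists_appellSeries_mul_thetaProd_analytic' hP0 hP (inv_ne_zero hp0)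
    hx₀ (inv_ne_zero hp0)
  obtain ⟨A₃, h₃, e₃⟩ := exists_appellSeries_mul_thetaProd_analytic' hP0 hP hp0 hx₀ hP0
  have j₁ : AnalyticAt ℂ (fun x => thetaProd (-x) (p ^ 3)) x₀ := by
    simpa using analyticAt_thetaProd_neg_mul hP one_ne_zero hx₀
  have j₂ := analyticAt_thetaProd_neg_mul hP (inv_ne_zero hp0) hx₀
  have j₃ := analyticAt_thetaProd_neg_mul hP hp0 hx₀
  refine ⟨_, ((((analyticAt_const (v := thetaSeries (p ^ 3) 1)).mul h₁).mul (j₂.mul j₃)).sub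
    (((analyticAt_const (v := thetaSeries (p ^ 3) 1)).mul h₂).mul (j₁.mul j₃))).sub
    (((analyticAt_const (v := 2 * p * thetaSeries (p ^ 3) (p ^ 2))).mul h₃).mul (j₁.mul j₂)), ?_⟩
  filter_upwards [e₁, e₂, e₃] with x x₁ x₂ x₃
  rw [clearedCombination_eq, x₁, x₂, x₃]
  rfl

lemma analyticAt_clearedCombination {p x₀ : ℂ} (hp0 : p ≠ 0) (hp : ‖p‖ < 1) (hx₀ : x₀ ≠ 0)
    (h : ∀ k : ℤ, 1 + x₀ * p ^ k ≠ 0) : AnalyticAt ℂ (clearedCombination p) x₀ := by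
  have hP0 := pow_ne_zero 3 hp0
  have hP := norm_pow_three_lt hp
  have g₁ := analyticAt_appellSeries hP0 hP hx₀ hp0
    (by simpa using one_add_zpow_mul_ne_zero hp0 h 0)
  have g₂ := analyticAt_appellSeries_mul hP0 hP (inv_ne_zero hp0) hx₀ (inv_ne_zero hp0)
    (by simpa using one_add_zpow_mul_ne_zero hp0 h (-1))
  have g₃ := analyticAt_appellSeries_mul hP0 hP hp0 hx₀ hP0
    (by simpa using one_add_zpow_mul_ne_zero hp0 h 1)
  have j₁ : AnalyticAt ℂ (fun x => thetaProd (-x) (p ^ 3)) x₀ := by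
    simpa using analyticAt_thetaProd_neg_mul hP one_ne_zero hx₀
  have j₂ := analyticAt_thetaProd_neg_mul hP (inv_ne_zero hp0) hx₀
  have j₃ := analyticAt_thetaProd_neg_mul hP hp0 hx₀
  exact ((analyticAt_const.mul (g₁.sub g₂)).sub (analyticAt_const.mul g₃)).mul
    ((j₁.mul j₂).mul j₃)

lemma tendsto_clearedCombination_neg_one {p : ℂ} (hp0 : p ≠ 0) (hp : ‖p‖ < 1) :
    Tendsto (clearedCombination p) (𝓝[≠] (-1)) (𝓝 (thetaSeries (p ^ 3) 1 * poch (p ^ 3) (p ^ 3) ^ 3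
      * (thetaProd p⁻¹ (p ^ 3) * thetaProd p (p ^ 3)))) := by
  have hP0 := pow_ne_zero 3 hp0
  have hP := norm_pow_three_lt hp
  have hm : (-1 : ℂ) ≠ 0 := by norm_num
  have hne : ∀ j : ℤ, (∀ k, j + 3 * k ≠ 0) → ∀ k : ℤ, 1 + p ^ j * -1 * (p ^ 3) ^ k ≠ 0 := by
    intro j hj k h
    refine zpow_ne_one_of_norm_lt_one hp (hj k) ?_
    rw [zpow_add₀ hp0, zpow_mul]
    exact_mod_cast (by linear_combination -h : p ^ j * (p ^ 3) ^ k = 1)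
  have le := nhdsWithin_le_nhds (a := (-1 : ℂ)) (s := {-1}ᶜ)
  have l₁ := appellSeries_mul_thetaProd_neg_one hP0 hP hp0
  have g₂ := (analyticAt_appellSeries_mul hP0 hP (inv_ne_zero hp0) hm (inv_ne_zero hp0)
    (by simpa using hne (-1) (by intro k; omega))).continuousAt.tendsto.mono_left le
  have g₃ := (analyticAt_appellSeries_mul hP0 hP hp0 hm hP0
    (by simpa using hne 1 (by intro k; omega))).continuousAt.tendsto.mono_left le
  have j₁ : ContinuousAt (fun x => thetaProd (-x) (p ^ 3)) (-1) := by
    simpa using (analyticAt_thetaProd_neg_mul hP one_ne_zero hm).continuousAt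
  have j₁' := j₁.tendsto.mono_left le
  have j₂ := (analyticAt_thetaProd_neg_mul hP (inv_ne_zero hp0) hm).continuousAt.tendsto.mono_left le
  have j₃ := (analyticAt_thetaProd_neg_mul hP hp0 hm).continuousAt.tendsto.mono_left le
  have hj : thetaProd 1 (p ^ 3) = 0 := thetaProd_eq_zero hP0 (k := 0) (by simp)
  have := (((l₁.const_mul (thetaSeries (p ^ 3) 1)).mul (j₂.mul j₃)).sub
    (((g₂.mul j₂).const_mul (thetaSeries (p ^ 3) 1)).mul (j₁'.mul j₃))).sub
    (((g₃.mul j₃).const_mul (2 * p * thetaSeries (p ^ 3) (p ^ 2))).mul (j₁'.mul j₂))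
  simp only [neg_neg, hj, zero_mul, mul_zero, sub_zero, mul_neg, mul_one] at this
  exact this.congr fun x => (clearedCombination_eq p x).symm

/-- The value of the combination at `1` as a product. -/
lemma appellCombination_one_mul {p : ℂ} (hp0 : p ≠ 0) (hp : ‖p‖ < 1)
    (hden : ∀ k : ℤ, p ^ k ≠ -1) :
    appellCombination p 1 * (thetaProd (-1) (p ^ 3) * thetaProd (-p) (p ^ 3) ^ 3)
      = thetaSeries (p ^ 3) 1 * (poch (p ^ 3) (p ^ 3) ^ 3 * thetaProd p (p ^ 3) ^ 3) := by
  have hP0 := pow_ne_zero 3 hp0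
  have hP := norm_pow_three_lt hp
  obtain ⟨M, hM⟩ := exists_analytic_extension fun x hx =>
    exists_clearedCombination_analytic hp0 hp (x₀ := x) hx
  have heq : ∀ x, x ≠ 0 → (∀ k : ℤ, 1 + x * p ^ k ≠ 0) → clearedCombination p x = M x :=
    fun x hx h => (((analyticAt_clearedCombination hp0 hp hx
      h).continuousAt.eventuallyEq_nhds_iff_eventuallyEq_nhdsNE
      (hM x hx).1.continuousAt).1 (hM x hx).2).eq_of_nhds
  have hshift : ∀ x, x ≠ 0 → M (p ^ 3 * x) = -(p ^ 2 / x) * M x := by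
    intro x hx
    have hPx := mul_ne_zero hP0 hx
    have c1 : ContinuousAt (fun x => M (p ^ 3 * x)) x :=
      (hM _ hPx).1.continuousAt.comp (f := fun x => p ^ 3 * x)
        (continuous_const_mul (p ^ 3)).continuousAt
    have c2 : ContinuousAt (fun x => -(p ^ 2 / x) * M x) x :=
      (continuousAt_const.div continuousAt_id hx).neg.mul (hM x hx).1.continuousAt
    refine ((c1.eventuallyEq_nhds_iff_eventuallyEq_nhdsNE c2).1 ?_).eq_of_nhds
    filter_upwards [(tendsto_const_mul_nhdsNE hP0 x).eventually (hM _ hPx).2, (hM x hx).2,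
      eventually_one_add_ne_zero hp0 hp hx, nhdsWithin_le_nhds (isOpen_ne.mem_nhds hx)]
      with y h1 h2 h3 h4
    rw [← h1, ← h2, clearedCombination_shift hp0 hp h4 h3]
  have hM2 : M (p ^ 2) = 0 := by
    rw [← heq _ (pow_ne_zero 2 hp0)
      (fun k => by exact_mod_cast one_add_zpow_mul_zpow_ne_zero hp0 hden 2 k), clearedCombination,
      appellCombination_sq_eq_zero hp0 hp hden, zero_mul]
  have hM1 := heq 1 one_ne_zero (by simpa using one_add_zpow_mul_zpow_ne_zero hp0 hden 0)
  have hMneg : M (-1) = _ := tendsto_nhds_unique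
    (((hM (-1) (by norm_num)).1.continuousAt.tendsto.mono_left nhdsWithin_le_nhds).congr'
      (hM (-1) (by norm_num)).2.symm) (tendsto_clearedCombination_neg_one hp0 hp)
  obtain ⟨C, hC⟩ := exists_eq_const_mul_thetaProd hP0 hP (pow_ne_zero 2 hp0)
    (fun x hx => (hM x hx).1.differentiableAt) hshift hM2
  have hn0 : 0 < ‖p‖ := norm_pos_iff.2 hp0
  have hlt1 : ‖p ^ 3‖ < (‖p‖ ^ 2)⁻¹ :=
    hP.trans (one_lt_inv₀ (by positivity) |>.2 (pow_lt_one₀ hn0.le hp (by norm_num)))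
  have hlt2 : (‖p‖ ^ 2)⁻¹ < ‖p ^ 3‖⁻¹ := by
    rw [norm_pow]
    exact (inv_lt_inv₀ (by positivity) (by positivity)).2
      (pow_lt_pow_right_of_lt_one₀ hn0 hp (by norm_num))
  have c1 := hC (p ^ 2)⁻¹ (by simpa using hlt1) (by simpa using hlt2)
  have c2 := hC (-(p ^ 2)⁻¹) (by simpa using hlt1) (by simpa using hlt2)
  rw [mul_neg, mul_inv_cancel₀ (pow_ne_zero 2 hp0), hMneg] at c2
  rw [mul_inv_cancel₀ (pow_ne_zero 2 hp0), ← hM1, clearedCombination] at c1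
  have s1 := thetaProd_shift hP0 hP (inv_ne_zero hp0)
  have s2 := thetaProd_shift hP0 hP (inv_ne_zero (pow_ne_zero 2 hp0))
  have s3 := thetaProd_shift hP0 hP (neg_ne_zero.2 (inv_ne_zero hp0))
  have s4 := thetaProd_shift hP0 hP (neg_ne_zero.2 (inv_ne_zero (pow_ne_zero 2 hp0)))
  have r1 := thetaProd_reflect hP0 hp0
  have r2 := thetaProd_reflect hP0 (neg_ne_zero.2 hp0)
  rw [show p ^ 3 * p⁻¹ = p ^ 3 / p by field_simp, r1] at s1
  rw [show p ^ 3 * (p ^ 2)⁻¹ = p by field_simp] at s2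
  rw [show p ^ 3 * -p⁻¹ = p ^ 3 / -p by field_simp, r2] at s3
  rw [show p ^ 3 * -(p ^ 2)⁻¹ = -p by field_simp] at s4
  have s1' : thetaProd p⁻¹ (p ^ 3) = -p⁻¹ * thetaProd p (p ^ 3) := by rw [s1]; field_simp
  have s2' : thetaProd (p ^ 2)⁻¹ (p ^ 3) = -(p ^ 2)⁻¹ * thetaProd p (p ^ 3) := by
    rw [s2]; field_simp
  have s3' : thetaProd (-p⁻¹) (p ^ 3) = p⁻¹ * thetaProd (-p) (p ^ 3) := by rw [s3]; field_simp
  have s4' : thetaProd (-(p ^ 2)⁻¹) (p ^ 3) = (p ^ 2)⁻¹ * thetaProd (-p) (p ^ 3) := by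
    rw [s4]; field_simp
  rw [s1', s4'] at c2
  rw [mul_one, mul_one, s3', s2'] at c1
  field_simp at c1 c2
  refine mul_left_cancel₀ hp0 ?_
  linear_combination thetaProd (-p) (p ^ 3) * c1 + thetaProd p (p ^ 3) * c2

lemma exists_thetaSeries_ne_zero {P : ℂ} (hP0 : P ≠ 0) (hP : ‖P‖ < 1) :
    ∃ z : ℂ, ‖z‖ = 1 ∧ thetaSeries P z ≠ 0 := by
  by_contra! hz
  let f : ℤ → C(ℝ, ℂ) := fun k =>
    ⟨fun t => thetaTerm P (exp (t * I)) k, by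
      unfold thetaTerm
      simp only [← exp_int_mul]
      fun_prop⟩
  have hnorm : ∀ t : ℝ, ‖exp (t * I)‖ = 1 := norm_exp_ofReal_mul_I
  have hs : Summable fun k => ‖(f k).restrict
      (⟨Set.uIcc 0 (2 * Real.pi), isCompact_uIcc⟩ : TopologicalSpace.Compacts ℝ)‖ := by
    refine .of_nonneg_of_le (fun k => norm_nonneg _) (fun k => ?_)
      (summable_norm_thetaTerm hP0 hP one_ne_zero)
    refine (ContinuousMap.norm_le _ (norm_nonneg _)).2 fun t => ?_
    simp [f, thetaTerm, hnorm]
  have h := intervalIntegral.hasSum_intervalIntegral_of_summable_norm hs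
  have h0 : ∀ t : ℝ, ∑' k, f k t = 0 := fun t => hz _ (hnorm t)
  have hk : ∀ k : ℤ, k ≠ 0 → ∫ t in (0 : ℝ)..2 * Real.pi, f k t = 0 := by
    intro k hk
    have e : ∀ t : ℝ, f k t = (-1) ^ k * P ^ (k ^ 2) * exp (k * I * t) := fun t => by
      simp only [f, thetaTerm, ContinuousMap.coe_mk, ← exp_int_mul]
      ring_nf
    have h2 : exp (k * I * (2 * Real.pi : ℝ)) = 1 := by
      rw [← exp_int_mul_two_pi_mul_I k]
      push_cast
      ring_nf
    simp_rw [e]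
    rw [intervalIntegral.integral_const_mul,
      integral_exp_mul_complex (mul_ne_zero (Int.cast_ne_zero.2 hk) I_ne_zero), h2]
    simp
  simp_rw [h0] at h
  have := (hasSum_single 0 hk).unique h
  simp [f, thetaTerm, Real.pi_ne_zero] at this

lemma poch_eq_mul_three {Q : ℂ} (hQ : ‖Q‖ < 1) (a : ℂ) :
    poch a Q = poch a (Q ^ 3) * poch (a * Q) (Q ^ 3) * poch (a * Q ^ 2) (Q ^ 3) := by
  have hQ3 := norm_pow_three_lt hQ
  have hmul : Tendsto (fun n : ℕ => 3 * n) atTop atTop :=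
    tendsto_id.const_mul_atTop' (by norm_num : 0 < 3)
  have h := (multipliable_poch hQ a).hasProd.tendsto_prod_nat.comp hmul
  refine tendsto_nhds_unique h ?_
  refine (((multipliable_poch hQ3 a).hasProd.tendsto_prod_nat.mul
    (multipliable_poch hQ3 (a * Q)).hasProd.tendsto_prod_nat).mul
    (multipliable_poch hQ3 (a * Q ^ 2)).hasProd.tendsto_prod_nat).congr fun n => ?_
  induction n with
  | zero => simp
  | succ n ih =>
    rw [Function.comp_apply] at ih ⊢
    simp only [Finset.prod_range_succ, Nat.mul_succ] at ih ⊢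
    rw [← ih]
    ring

lemma exists_thetaSeries_cube_eq {p : ℂ} (hp0 : p ≠ 0) (hp : ‖p‖ < 1) :
    ∃ C ≠ 0, thetaSeries (p ^ 3) 1 = C * thetaProd (p ^ 3) (p ^ 6)
      ∧ thetaSeries (p ^ 3) (p ^ 2) = C * thetaProd (p ^ 5) (p ^ 6) := by
  have hP0 := pow_ne_zero 3 hp0
  have hP := norm_pow_three_lt hp
  have hn0 : 0 < ‖p‖ := norm_pos_iff.2 hp0
  obtain ⟨C, hC⟩ := exists_thetaSeries_eq_const_mul hP0 hP
  rw [← pow_mul] at hC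
  have hlt : ∀ k < 6, ‖p ^ 6‖ < ‖p ^ k‖ := fun k hk => by
    rw [norm_pow, norm_pow]
    exact pow_lt_pow_right_of_lt_one₀ hn0 hp hk
  have hlt' : ∀ k, ‖p ^ k‖ < ‖p ^ 6‖⁻¹ := fun k => by
    rw [norm_pow, norm_pow]
    exact (pow_le_one₀ hn0.le hp.le).trans_lt
      ((one_lt_inv₀ (by positivity)).2 (pow_lt_one₀ hn0.le hp (by norm_num)))
  refine ⟨C, ?_, ?_, ?_⟩
  · rintro rfl
    obtain ⟨z, hz, hne⟩ := exists_thetaSeries_ne_zero hP0 hP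
    refine hne ?_
    have hn : ‖p ^ 3 * z‖ = ‖p ^ 3‖ := by rw [norm_mul, hz, mul_one]
    have := hC (p ^ 3 * z) (hn ▸ hlt 3 (by norm_num)) (hn ▸ hlt' 3)
    rwa [inv_mul_cancel_left₀ hP0, zero_mul] at this
  · have := hC (p ^ 3) (hlt 3 (by norm_num)) (hlt' 3)
    rwa [inv_mul_cancel₀ hP0] at this
  · have := hC (p ^ 5) (hlt 5 (by norm_num)) (hlt' 5)
    rwa [show (p ^ 3)⁻¹ * p ^ 5 = p ^ 2 by field_simp] at this

lemma appellCombination_one {p : ℂ} (hp0 : p ≠ 0) (hp : ‖p‖ < 1)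
    (hden : ∀ k : ℤ, p ^ k ≠ -1) :
    appellCombination p 1 = thetaSeries (p ^ 3) 1 * (thetaProd p (p ^ 6) ^ 6
      * poch (p ^ 2) (p ^ 2) ^ 3 * thetaProd (p ^ 3) (p ^ 6) ^ 2
      / (2 * poch (p ^ 6) (p ^ 6) ^ 9)) := by
  have hP0 := pow_ne_zero 3 hp0
  have hP := norm_pow_three_lt hp
  have hp2 : ‖p ^ 2‖ < 1 := by
    rw [norm_pow]; exact pow_lt_one₀ (norm_nonneg p) hp (by norm_num)
  have hp6 : ‖p ^ 6‖ < 1 := by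
    rw [norm_pow]; exact pow_lt_one₀ (norm_nonneg p) hp (by norm_num)
  have hne : ∀ i : ℕ, i ≠ 0 → poch (p ^ i) (p ^ 6) ≠ 0 := fun i hi =>
    poch_ne_zero hp6 fun n h => zpow_ne_one_of_norm_lt_one hp (k := (i + 6 * n : ℕ)) (by omega)
      (by rw [zpow_natCast, pow_add, pow_mul, h])
  have h1 : poch p (p ^ 6) ≠ 0 := by simpa using hne 1 one_ne_zero
  have h2 := hne 2 (by norm_num)
  have h3 := hne 3 (by norm_num)
  have h4 := hne 4 (by norm_num)
  have h5 := hne 5 (by norm_num)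
  have h6 := hne 6 (by norm_num)
  have e1 := poch_even_mul_odd hP p
  have e2 := poch_even_mul_odd hP (p ^ 2)
  have e3 := poch_even_mul_odd hP (p ^ 3)
  have n1 := poch_mul_poch_neg hP p
  have n2 := poch_mul_poch_neg hP (p ^ 2)
  have n3 := poch_mul_poch_neg hP (p ^ 3)
  have t := poch_eq_mul_three hp2 (p ^ 2)
  have s := poch_step hP (-1)
  rw [← pow_mul, show p * p ^ 3 = p ^ 4 by ring] at e1
  rw [← pow_mul, ← pow_add] at e2 e3
  rw [← pow_mul] at n1 n3
  rw [← pow_mul, ← pow_mul] at n2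
  rw [← pow_mul, ← pow_mul, ← pow_add, ← pow_add] at t
  rw [neg_one_mul] at s
  norm_num only at e1 e2 e3 n1 n2 n3 t s
  rw [e1] at n1
  rw [e2] at n2
  rw [e3] at n3
  have m1 : poch (-p) (p ^ 3) = poch (p ^ 2) (p ^ 6) / (poch p (p ^ 6) * poch (p ^ 4) (p ^ 6)) := by
    rw [← n1]; field_simp
  have m2 : poch (-p ^ 2) (p ^ 3)
      = poch (p ^ 4) (p ^ 6) / (poch (p ^ 2) (p ^ 6) * poch (p ^ 5) (p ^ 6)) := by
    rw [← n2]; field_simp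
  have m3 : poch (-p ^ 3) (p ^ 3) = 1 / poch (p ^ 3) (p ^ 6) := by
    rw [eq_div_iff h3]
    exact mul_right_cancel₀ h6 (by linear_combination n3)
  have main := appellCombination_one_mul hp0 hp hden
  unfold thetaProd at main ⊢
  rw [show p ^ 3 / -1 = -p ^ 3 by ring, show p ^ 3 / -p = -p ^ 2 by field_simp,
    show p ^ 3 / p = p ^ 2 by field_simp, s, e1, e2, e3, m1, m2, m3] at main
  rw [show p ^ 6 / p = p ^ 5 by field_simp, show p ^ 6 / p ^ 3 = p ^ 3 by field_simp, t]
  field_simp at main ⊢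
  linear_combination main

/-- Splitting a series over `ℤ` into residue classes modulo three. -/
lemma tsum_int_eq_tsum_mod_three {f : ℤ → ℂ} (hf : Summable f) :
    ∑' n, f n = ∑' k, f (3 * k) + ∑' k, f (3 * k + 1) + ∑' k, f (3 * k + 2) := by
  have hr : ∀ r : ℤ, Summable fun k : ℤ => f (3 * k + r) := fun r =>
    hf.comp_injective (i := fun k : ℤ => 3 * k + r) fun a b h => by
      have : 3 * a + r = 3 * b + r := h
      omega
  have h0 : Summable fun k : ℤ => f (3 * k) := by simpa using hr 0
  have hs : Summable fun c : ℤ × Fin 3 => f ((Int.divModEquiv 3).symm c) :=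
    (Int.divModEquiv 3).symm.summable_iff.2 hf
  rw [← (Int.divModEquiv 3).symm.tsum_eq, hs.tsum_prod,
    ← h0.tsum_add (hr 1), ← (h0.add (hr 1)).tsum_add (hr 2)]
  refine tsum_congr fun k => ?_
  rw [tsum_fintype, Fin.sum_univ_three]
  simp [Int.divModEquiv, mul_comm]

lemma summable_thetaTerm_div {q : ℂ} (hq0 : q ≠ 0) (hq : ‖q‖ < 1) :
    Summable fun n : ℤ => (-1 : ℂ) ^ n * q ^ (n ^ 2 + n) / (1 + q ^ (3 * n)) := by
  have hp0 := pow_ne_zero 3 hq0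
  have hp := norm_pow_three_lt hq
  obtain ⟨k₀, hk₀⟩ := exists_forall_ne_one_add_ne_zero hp0 hp 1
  obtain ⟨δ, hδ, h⟩ := exists_le_norm_one_add hp0 hp one_ne_zero hk₀
  refine Summable.of_norm_bounded_eventually
    ((summable_norm_thetaTerm hq0 hq hq0).mul_right δ⁻¹) ?_
  filter_upwards [(Set.finite_singleton k₀).compl_mem_cofinite] with k hk
  have hb := h.self_of_nhds k hk
  rw [one_mul, ← zpow_natCast, ← zpow_mul] at hb
  rw [norm_div, div_eq_mul_inv, zpow_add₀ hq0, ← mul_assoc]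
  unfold thetaTerm
  gcongr
  exact hb

lemma tsum_thetaTerm_div_eq {q : ℂ} (hq0 : q ≠ 0) (hq : ‖q‖ < 1) :
    ∑' n : ℤ, (-1 : ℂ) ^ n * q ^ (n ^ 2 + n) / (1 + q ^ (3 * n))
      = appellSeries ((q ^ 3) ^ 3) 1 (q ^ 3)
        - ∑' n : ℤ, (-1 : ℂ) ^ n * q ^ (9 * n ^ 2 + 9 * n + 2) / (1 + q ^ (9 * n + 3))
        - appellSeries ((q ^ 3) ^ 3) (q ^ 3)⁻¹ (q ^ 3)⁻¹ := by
  have hp0 := pow_ne_zero 3 hq0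
  have hP0 := pow_ne_zero 3 hp0
  have hs3 : ∀ k : ℤ, (-1 : ℂ) ^ (3 * k) = (-1) ^ k := fun k => by
    rw [zpow_mul]; norm_num
  have c0 : ∀ k : ℤ, (-1 : ℂ) ^ (3 * k) * q ^ ((3 * k) ^ 2 + 3 * k) / (1 + q ^ (3 * (3 * k)))
      = thetaTerm ((q ^ 3) ^ 3) (q ^ 3) k / (1 + 1 * ((q ^ 3) ^ 3) ^ k) := fun k => by
    rw [hs3, thetaTerm]
    simp only [← zpow_natCast, ← zpow_mul]
    rw [mul_assoc, ← zpow_add₀ hq0, one_mul]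
    push_cast
    ring_nf
  have c1 : ∀ k : ℤ, (-1 : ℂ) ^ (3 * k + 1) * q ^ ((3 * k + 1) ^ 2 + (3 * k + 1))
      / (1 + q ^ (3 * (3 * k + 1)))
      = -((-1 : ℂ) ^ k * q ^ (9 * k ^ 2 + 9 * k + 2) / (1 + q ^ (9 * k + 3))) := fun k => by
    rw [zpow_add₀ (by norm_num), hs3]
    ring_nf
  have c2 : ∀ k : ℤ, (-1 : ℂ) ^ (3 * k + 2) * q ^ ((3 * k + 2) ^ 2 + (3 * k + 2))
      / (1 + q ^ (3 * (3 * k + 2)))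
      = (q ^ 3) ^ 2 * (thetaTerm ((q ^ 3) ^ 3) ((q ^ 3) ^ 5) k
        / (1 + (q ^ 3)⁻¹ * (q ^ 3) ^ 3 * ((q ^ 3) ^ 3) ^ k)) := fun k => by
    rw [show (q ^ 3)⁻¹ * (q ^ 3) ^ 3 = (q ^ 3) ^ 2 by field_simp, zpow_add₀ (by norm_num), hs3,
      thetaTerm, mul_div_assoc']
    simp only [← zpow_natCast, ← zpow_mul]
    rw [← zpow_add₀ hq0, mul_assoc ((-1 : ℂ) ^ k) (q ^ _) (q ^ _), ← zpow_add₀ hq0,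
      mul_left_comm, ← zpow_add₀ hq0]
    push_cast
    ring_nf
  have h := appellSeries_mul (x := (q ^ 3)⁻¹) hP0 (pow_ne_zero 5 hp0)
  rw [show (q ^ 3) ^ 5 / ((q ^ 3) ^ 3) ^ 2 = (q ^ 3)⁻¹ by field_simp] at h
  rw [tsum_int_eq_tsum_mod_three (summable_thetaTerm_div hq0 hq), tsum_congr c0, tsum_congr c1,
    tsum_congr c2, tsum_neg, tsum_mul_left]
  change appellSeries _ _ _ + _ + _ * appellSeries _ _ _ = _
  rw [h]
  field_simp
  ring

lemma tsum_eq_sq_mul_appellSeries {q : ℂ} (hq0 : q ≠ 0) :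
    ∑' n : ℤ, (-1 : ℂ) ^ n * q ^ (9 * n ^ 2 + 9 * n + 2) / (1 + q ^ (9 * n + 3))
      = q ^ 2 * appellSeries ((q ^ 3) ^ 3) (q ^ 3) ((q ^ 3) ^ 3) := by
  unfold appellSeries
  rw [← tsum_mul_left]
  refine tsum_congr fun k => ?_
  rw [thetaTerm, mul_div_assoc']
  simp only [← zpow_natCast, ← zpow_mul]
  rw [← zpow_add₀ hq0, mul_assoc ((-1 : ℂ) ^ k) (q ^ _) (q ^ _), ← zpow_add₀ hq0,
    mul_left_comm, ← zpow_add₀ hq0]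
  push_cast
  ring_nf

theorem stmt15 (q : ℂ) (hq0 : 0 < ‖q‖) (hq : ‖q‖ < 1)
    (hden : ∀ m : ℤ, q ^ m ≠ -1) :
    (∑' n : ℤ, (-1 : ℂ) ^ n * q ^ (n ^ 2 + n) / (1 + q ^ (3 * n)))
      = (2 * q * Jam 3 18 q / Jam 9 18 q - 1)
          * (∑' n : ℤ, (-1 : ℂ) ^ n * q ^ (9 * n ^ 2 + 9 * n + 2) / (1 + q ^ (9 * n + 3)))
        + (Jam 3 18 q) ^ 6 * (Jm 6 q) ^ 3 * (Jam 9 18 q) ^ 2 / (2 * (Jm 18 q) ^ 9) := by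
  have hq0' : q ≠ 0 := norm_pos_iff.1 hq0
  have hp0 := pow_ne_zero 3 hq0'
  have hp := norm_pow_three_lt hq
  have hdenp : ∀ k : ℤ, (q ^ 3) ^ k ≠ -1 := fun k => by
    rw [← zpow_natCast, ← zpow_mul]
    exact hden _
  have hp6 : ‖(q ^ 3) ^ 6‖ < 1 := by
    rw [norm_pow]; exact pow_lt_one₀ (norm_nonneg _) hp (by norm_num)
  have j1 : Jam 3 18 q = thetaProd (q ^ 3) ((q ^ 3) ^ 6) := by
    rw [Jam, thetaProd, show (q ^ 3) ^ 6 / q ^ 3 = q ^ (18 - 3) by norm_num; field_simp,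
      ← pow_mul]
  have j3 : Jam 9 18 q = thetaProd ((q ^ 3) ^ 3) ((q ^ 3) ^ 6) := by
    rw [Jam, thetaProd, show (q ^ 3) ^ 6 / (q ^ 3) ^ 3 = q ^ (18 - 9) by norm_num; field_simp,
      ← pow_mul, ← pow_mul]
  have jr := thetaProd_reflect (Q := (q ^ 3) ^ 6) (pow_ne_zero 6 hp0) hp0
  rw [show (q ^ 3) ^ 6 / q ^ 3 = (q ^ 3) ^ 5 by field_simp] at jr
  have j3ne : thetaProd ((q ^ 3) ^ 3) ((q ^ 3) ^ 6) ≠ 0 :=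
    thetaProd_ne_zero (pow_ne_zero 6 hp0) hp6 (pow_ne_zero 3 hp0) fun k h =>
      zpow_ne_one_of_norm_lt_one hp (k := 3 + 6 * k) (by omega)
        (by rw [zpow_add₀ hp0, zpow_mul]; exact_mod_cast h)
  have main := appellCombination_one hp0 hp hdenp
  obtain ⟨C, hC, t1, t2⟩ := exists_thetaSeries_cube_eq hp0 hp
  rw [appellCombination, t1, t2, jr, mul_one, mul_one] at main
  rw [tsum_thetaTerm_div_eq hq0' hq, tsum_eq_sq_mul_appellSeries hq0', j1, j3,
    show Jm 6 q = poch ((q ^ 3) ^ 2) ((q ^ 3) ^ 2) by rw [Jm, ← pow_mul],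
    show Jm 18 q = poch ((q ^ 3) ^ 6) ((q ^ 3) ^ 6) by rw [Jm, ← pow_mul]]
  set K := thetaProd (q ^ 3) ((q ^ 3) ^ 6) ^ 6 * poch ((q ^ 3) ^ 2) ((q ^ 3) ^ 2) ^ 3
    * thetaProd ((q ^ 3) ^ 3) ((q ^ 3) ^ 6) ^ 2 / (2 * poch ((q ^ 3) ^ 6) ((q ^ 3) ^ 6) ^ 9)
  set T1 := thetaProd (q ^ 3) ((q ^ 3) ^ 6)
  set T3 := thetaProd ((q ^ 3) ^ 3) ((q ^ 3) ^ 6)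
  have key : T3 * (appellSeries ((q ^ 3) ^ 3) 1 (q ^ 3)
        - appellSeries ((q ^ 3) ^ 3) (q ^ 3)⁻¹ (q ^ 3)⁻¹)
      - 2 * q ^ 3 * T1 * appellSeries ((q ^ 3) ^ 3) (q ^ 3) ((q ^ 3) ^ 3) = T3 * K :=
    mul_left_cancel₀ hC (by linear_combination main)
  refine mul_left_cancel₀ j3ne ?_
  have hdiv : T3 * (2 * q * T1 / T3 - 1) = 2 * q * T1 - T3 := by field_simp
  linear_combination key
    - q ^ 2 * appellSeries ((q ^ 3) ^ 3) (q ^ 3) ((q ^ 3) ^ 3) * hdiv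
end

section
/- For |q|<1, the generating function identity Σ_{n≥0} (N̄(0,6,n) + N̄(1,6,n) − N̄(2,6,n) − N̄(3,6,n)) q^n = (2(-q;q)_∞/(q;q)_∞)·Σ_{n∈ℤ} (-1)^n q^{n²+n}/(1+q^{3n}) holds. -/
open scoped BigOperators

/-- The rank of an overpartition (parts with a set of overlined part sizes):
largest part minus number of parts. -/
noncomputable def overRank (p : Multiset ℕ × Finset ℕ) : ℤ :=
  ((p.1.toFinset.sup (id : ℕ → ℕ) : ℕ) : ℤ) - p.1.card

/-- Number of overpartitions of n whose rank is congruent to s modulo 6. -/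
noncomputable def Nbar (s n : ℕ) : ℕ :=
  Set.ncard {p : Multiset ℕ × Finset ℕ |
    p.1.sum = n ∧ 0 ∉ p.1 ∧ p.2 ⊆ p.1.toFinset ∧ overRank p % 6 = (s : ℤ)}

/-- `rankTerm q N j` is `q ^ N` times the coefficient of `x ^ j` in
`∏_{i=1}^{N} (1 + x q ^ i) / ∏_{i=1}^{N+1} (1 - x q ^ i)`. Then `2 * q * rankTerm q N j` is the
generating function of the overpartitions with largest part `N + 1` and `j + 1` parts. -/
noncomputable def rankTerm (q : ℂ) : ℕ → ℕ → ℂ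
  | 0, j => q ^ j
  | N + 1, 0 => q ^ (N + 1)
  | N + 1, j + 1 =>
    q ^ (N + 2) * rankTerm q (N + 1) j + q * rankTerm q N (j + 1) + q ^ (N + 2) * rankTerm q N j

lemma rankTerm_zero_left (q : ℂ) (j : ℕ) : rankTerm q 0 j = q ^ j := by rw [rankTerm]

lemma rankTerm_zero_right (q : ℂ) (N : ℕ) : rankTerm q N 0 = q ^ N := by
  cases N <;> rw [rankTerm]

lemma rankTerm_succ_succ (q : ℂ) (N j : ℕ) : rankTerm q (N + 1) (j + 1) =
    q ^ (N + 2) * rankTerm q (N + 1) j + q * rankTerm q N (j + 1)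
      + q ^ (N + 2) * rankTerm q N j := by
  rw [rankTerm]

lemma rankTerm_succ_succ' (q : ℂ) (N j : ℕ) : rankTerm q (N + 1) (j + 1) =
    q ^ (j + 2) * rankTerm q N (j + 1) + q * rankTerm q (N + 1) j
      + q ^ (j + 2) * rankTerm q N j := by
  induction N generalizing j with
  | zero =>
    induction j with
    | zero => simp [rankTerm_succ_succ, rankTerm_zero_left, rankTerm_zero_right]
    | succ j ih =>
      have h₁ := rankTerm_succ_succ q 0 (j + 1)
      have h₂ := rankTerm_succ_succ q 0 j
      simp only [rankTerm_zero_left] at *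
      linear_combination h₁ + q ^ 2 * ih - q * h₂
  | succ N ihN =>
    induction j with
    | zero =>
      have h₁ := rankTerm_succ_succ q (N + 1) 0
      have h₂ := rankTerm_succ_succ q N 0
      have h₃ := ihN 0
      simp only [rankTerm_zero_right] at *
      linear_combination h₁ + q * h₃ - q ^ 2 * h₂
    | succ j ihj =>
      linear_combination rankTerm_succ_succ q (N + 1) (j + 1) + q ^ (N + 3) * ihj
        + q * ihN (j + 1) + q ^ (N + 3) * ihN j - q ^ (j + 3) * rankTerm_succ_succ q N (j + 1)
        - q * rankTerm_succ_succ q (N + 1) j - q ^ (j + 3) * rankTerm_succ_succ q N j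

/-- Conjugation of overpartitions. -/
lemma rankTerm_comm (q : ℂ) (N j : ℕ) : rankTerm q N j = rankTerm q j N := by
  induction N generalizing j with
  | zero => rw [rankTerm_zero_left, rankTerm_zero_right]
  | succ N ihN =>
    induction j with
    | zero => rw [rankTerm_zero_left, rankTerm_zero_right]
    | succ j ihj =>
      rw [rankTerm_succ_succ, rankTerm_succ_succ' q j N, ihj, ihN, ihN]

/-- The quotient `(-q; q)_k / (q; q)_k`. -/
noncomputable def pochQuot (q : ℂ) (k : ℕ) : ℂ :=
  ∏ i ∈ Finset.range k, (1 + q ^ (i + 1)) / (1 - q ^ (i + 1))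

/-- The quotient `(-1; q)_M / (q; q)_M`. -/
noncomputable def pochQuotOne (q : ℂ) (M : ℕ) : ℂ := 2 * pochQuot q M / (1 + q ^ M)

section

variable {q : ℂ} (hq : ‖q‖ < 1)
include hq

lemma norm_pow_lt_one (n : ℕ) : ‖q ^ (n + 1)‖ < 1 := by
  rw [norm_pow]
  exact pow_lt_one₀ (norm_nonneg q) hq n.succ_ne_zero

lemma one_sub_pow_ne_zero (n : ℕ) : 1 - q ^ (n + 1) ≠ 0 := by
  intro h
  have := norm_pow_lt_one hq n
  rw [← sub_eq_zero.mp h] at this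
  simp at this

lemma one_add_pow_succ_ne_zero (n : ℕ) : 1 + q ^ (n + 1) ≠ 0 := by
  intro h
  have := norm_pow_lt_one hq n
  rw [← neg_eq_of_add_eq_zero_right h] at this
  simp at this

lemma one_add_pow_ne_zero (n : ℕ) : 1 + q ^ n ≠ 0 := by
  cases n with
  | zero => norm_num
  | succ n => exact one_add_pow_succ_ne_zero hq n

lemma pochQuot_succ (k : ℕ) :
    pochQuot q (k + 1) * (1 - q ^ (k + 1)) = pochQuot q k * (1 + q ^ (k + 1)) := by
  have := one_sub_pow_ne_zero hq k
  rw [pochQuot, Finset.prod_range_succ, ← pochQuot]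
  field_simp

lemma pochQuot_ne_zero (k : ℕ) : pochQuot q k ≠ 0 :=
  Finset.prod_ne_zero_iff.mpr fun i _ =>
    div_ne_zero (one_add_pow_succ_ne_zero hq i) (one_sub_pow_ne_zero hq i)

lemma pochQuotOne_succ (M : ℕ) :
    pochQuotOne q (M + 1) * (1 - q ^ (M + 1)) = pochQuotOne q M * (1 + q ^ M) := by
  have h := pochQuot_succ hq M
  have h₁ := one_add_pow_ne_zero hq M
  have h₂ := one_add_pow_ne_zero hq (M + 1)
  rw [pochQuotOne, pochQuotOne]
  field_simp
  linear_combination h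

end

lemma pochQuot_zero (q : ℂ) : pochQuot q 0 = 1 := by simp [pochQuot]

lemma pochQuotOne_zero (q : ℂ) : pochQuotOne q 0 = 1 := by
  norm_num [pochQuotOne, pochQuot_zero]

open PowerSeries in
/-- The Cauchy product of the `q`-binomial series of `(qt; q)_∞ / (-t; q)_∞` and
`(-t; q)_∞ / (t; q)_∞` is the geometric series. -/
lemma sum_antidiagonal_pochQuot {q : ℂ} (hq : ‖q‖ < 1) (N : ℕ) :
    ∑ p ∈ Finset.HasAntidiagonal.antidiagonal N,
      (-1) ^ p.1 * pochQuot q p.1 * pochQuotOne q p.2 = 1 := by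
  set U : PowerSeries ℂ := PowerSeries.mk fun k => (-1) ^ k * pochQuot q k with hU
  set V : PowerSeries ℂ := PowerSeries.mk (pochQuotOne q) with hV
  have hUq : (1 + X) * U = (1 - C q * X) * rescale q U := by
    ext n
    cases n with
    | zero =>
      simp [hU, add_mul, sub_mul, mul_assoc]
      rw [← coeff_zero_eq_constantCoeff_apply, coeff_rescale]
      simp
    | succ n =>
      simp only [add_mul, sub_mul, one_mul, mul_assoc, map_add, map_sub, coeff_C_mul,
        coeff_succ_X_mul, coeff_rescale, hU, coeff_mk]
      linear_combination (-1) ^ (n + 1) * pochQuot_succ hq n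
  have hVq : (1 - X) * V = (1 + X) * rescale q V := by
    ext n
    cases n with
    | zero =>
      simp [hV, add_mul, sub_mul]
      rw [← coeff_zero_eq_constantCoeff_apply, coeff_rescale]
      simp
    | succ n =>
      simp only [add_mul, sub_mul, one_mul, map_add, map_sub, coeff_succ_X_mul, coeff_rescale,
        hV, coeff_mk]
      linear_combination pochQuotOne_succ hq n
  set W : PowerSeries ℂ := (1 - X) * (U * V) with hW
  have hWq : rescale q W = W := by
    have hX : rescale q (X : PowerSeries ℂ) = C q * X := by
      ext n
      simp [coeff_X]
    rw [hW, map_mul, map_mul, map_sub, map_one, hX]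
    linear_combination - U * hVq - rescale q V * hUq
  have hW1 : W = 1 := by
    ext n
    cases n with
    | zero => simp [hW, hU, hV, pochQuot_zero, pochQuotOne_zero]
    | succ n =>
      have h := congrArg (coeff (n + 1)) hWq
      rw [coeff_rescale] at h
      have h0 : (1 - q ^ (n + 1)) * coeff (n + 1) W = 0 := by linear_combination - h
      rw [(mul_eq_zero.mp h0).resolve_left (one_sub_pow_ne_zero hq n)]
      simp [coeff_one]
  have hUV : U * V = PowerSeries.mk 1 := by
    calc U * V = (1 - X) * (PowerSeries.mk 1) * (U * V) := by
          rw [mul_comm (1 - X), PowerSeries.mk_one_mul_one_sub_eq_one, one_mul]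
      _ = PowerSeries.mk 1 * W := by rw [hW]; ring
      _ = _ := by rw [hW1, mul_one]
  simpa [coeff_mul, hU, hV] using congrArg (coeff N) hUV

/-- The partial fraction expansion of `∏_{i=1}^{N} (1 + x q ^ i) / ∏_{i=1}^{N+1} (1 - x q ^ i)`,
coefficientwise. -/
lemma rankTerm_eq_sum {q : ℂ} (hq : ‖q‖ < 1) (N j : ℕ) :
    rankTerm q N j = ∑ p ∈ Finset.HasAntidiagonal.antidiagonal N,
      (-1) ^ p.1 * pochQuot q p.1 * pochQuotOne q p.2 * q ^ (p.1 + p.2 + (p.1 + 1) * j) := by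
  induction N generalizing j with
  | zero => simp [rankTerm_zero_left, pochQuot_zero, pochQuotOne_zero]
  | succ N ihN =>
    induction j with
    | zero =>
      rw [rankTerm_zero_right]
      refine (one_mul (q ^ (N + 1))).symm.trans ?_
      nth_rw 1 [← sum_antidiagonal_pochQuot hq (N + 1), Finset.sum_mul]
      refine Finset.sum_congr rfl fun p hp => ?_
      rw [mul_zero, add_zero, Finset.HasAntidiagonal.mem_antidiagonal.mp hp]
    | succ j ihj =>
      rw [rankTerm_succ_succ, ihj, ihN, ihN, Finset.Nat.sum_antidiagonal_succ',
        Finset.Nat.sum_antidiagonal_succ', mul_add, Finset.mul_sum, Finset.mul_sum,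
        Finset.mul_sum, add_assoc, add_assoc, ← Finset.sum_add_distrib, ← Finset.sum_add_distrib]
      congr 1
      · ring
      refine Finset.sum_congr rfl fun p hp => ?_
      obtain rfl := Finset.HasAntidiagonal.mem_antidiagonal.mp hp
      linear_combination - (-1) ^ p.1 * pochQuot q p.1 * q ^ (p.1 + p.2 + 1 + (p.1 + 1) * (j + 1))
        * pochQuotOne_succ hq p.2

section

open Filter Topology

variable {q : ℂ} (hq : ‖q‖ < 1)
include hq

lemma tendsto_pochQuot : Tendsto (pochQuot q) atTop (𝓝 (poch (-q) q / poch q q)) := by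
  have hs : Summable fun n : ℕ => ‖q * q ^ n‖ := by
    simpa only [norm_mul, norm_pow] using
      (summable_geometric_of_lt_one (norm_nonneg q) hq).mul_left ‖q‖
  have hs' : Summable fun n : ℕ => ‖-(q * q ^ n)‖ := by simpa only [norm_neg] using hs
  have h₁ : Tendsto (fun k => ∏ i ∈ Finset.range k, (1 + q * q ^ i)) atTop
      (𝓝 (poch (-q) q)) := by
    simpa [poch] using (multipliable_one_add_of_summable hs).tendsto_prod_tprod_nat
  have h₂ : Tendsto (fun k => ∏ i ∈ Finset.range k, (1 + -(q * q ^ i))) atTop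
      (𝓝 (poch q q)) := by
    simpa [poch, sub_eq_add_neg] using
      (multipliable_one_add_of_summable hs').tendsto_prod_tprod_nat
  have h₀ : poch q q ≠ 0 := by
    simpa [poch, sub_eq_add_neg] using tprod_one_add_ne_zero_of_summable
      (fun i => by simpa [pow_succ', sub_eq_add_neg] using one_sub_pow_ne_zero hq i) hs'
  refine (h₁.div h₂ h₀).congr fun k => ?_
  rw [Pi.div_apply, pochQuot, ← Finset.prod_div_distrib]
  exact Finset.prod_congr rfl fun i _ => by rw [pow_succ', sub_eq_add_neg]

lemma tendsto_pochQuotOne :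
    Tendsto (pochQuotOne q) atTop (𝓝 (2 * (poch (-q) q / poch q q))) := by
  have h := ((tendsto_pochQuot hq).const_mul 2).div
    ((tendsto_pow_atTop_nhds_zero_of_norm_lt_one hq).const_add 1) (by simp)
  change Tendsto (fun M => 2 * pochQuot q M / (1 + q ^ M)) _ _
  simpa [Pi.div_def] using h

lemma exists_norm_pochQuot_le :
    ∃ C : ℝ, ∀ k, ‖pochQuot q k‖ ≤ C ∧ ‖pochQuotOne q k‖ ≤ C := by
  obtain ⟨C, hC⟩ := (Metric.isBounded_range_of_tendsto _ (tendsto_pochQuot hq)).exists_norm_le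
  obtain ⟨D, hD⟩ := (Metric.isBounded_range_of_tendsto _ (tendsto_pochQuotOne hq)).exists_norm_le
  exact ⟨max C D, fun k => ⟨(hC _ ⟨k, rfl⟩).trans (le_max_left _ _),
    (hD _ ⟨k, rfl⟩).trans (le_max_right _ _)⟩⟩

lemma norm_pow_le_pow {m n : ℕ} (h : m ≤ n) : ‖q ^ n‖ ≤ ‖q‖ ^ m := by
  rw [norm_pow]
  exact pow_le_pow_of_le_one (norm_nonneg q) hq.le h

lemma summable_rankTerm : Summable fun p : ℕ × ℕ => ‖rankTerm q p.1 p.2‖ := by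
  obtain ⟨C, hC⟩ := exists_norm_pochQuot_le hq
  have hC0 : 0 ≤ C := (norm_nonneg _).trans (hC 0).1
  have hgeom := summable_geometric_of_lt_one (norm_nonneg q) hq
  have hN : Summable fun N : ℕ => C * C * ((N : ℝ) ^ 1 * ‖q‖ ^ N + ‖q‖ ^ N) :=
    ((summable_pow_mul_geometric_of_norm_lt_one 1 (by simpa using hq)).add hgeom).mul_left _
  refine (hN.mul_of_nonneg hgeom (fun N => by positivity) fun j => by positivity).of_nonneg_of_le
    (fun p => norm_nonneg _) fun ⟨N, j⟩ => ?_
  rw [rankTerm_eq_sum hq]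
  refine (norm_sum_le_of_le (f := _) (n := fun _ => C * C * ‖q‖ ^ (N + j)) _
    fun p hp => ?_).trans (le_of_eq ?_)
  · have hle : N + j ≤ p.1 + p.2 + (p.1 + 1) * j := by
      rw [Finset.HasAntidiagonal.mem_antidiagonal.mp hp]
      gcongr
      nlinarith
    rw [norm_mul, norm_mul, norm_mul, norm_pow (-1 : ℂ), norm_neg, norm_one, one_pow, one_mul]
    gcongr
    exacts [(hC _).1, (hC _).2, norm_pow_le_pow hq hle]
  · simp only [Finset.sum_const, Finset.Nat.card_antidiagonal, nsmul_eq_mul]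
    push_cast
    ring

lemma summable_pochQuotOne (i : ℕ) :
    Summable fun M => pochQuotOne q M * (q ^ (i + 1)) ^ M := by
  obtain ⟨C, hC⟩ := exists_norm_pochQuot_le hq
  refine Summable.of_norm_bounded
    ((summable_geometric_of_lt_one (norm_nonneg _) (norm_pow_lt_one hq i)).mul_left C)
    fun M => ?_
  rw [norm_mul, norm_pow]
  gcongr
  exact (hC M).2

/-- The `q`-binomial theorem at the powers of `q`. -/
lemma hasSum_pochQuotOne (i : ℕ) : HasSum (fun M => pochQuotOne q M * (q ^ (i + 1)) ^ M)
    (poch (-q) q / poch q q / pochQuot q i) := by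
  induction i with
  | zero =>
    rw [pochQuot_zero, div_one, (summable_pochQuotOne hq 0).hasSum_iff_tendsto_nat,
      ← tendsto_add_atTop_iff_nat 1]
    refine (tendsto_pochQuot hq).congr fun n => ?_
    induction n with
    | zero => simp [pochQuot_zero, pochQuotOne_zero]
    | succ n ih =>
      have h := pochQuot_succ hq n
      have h₁ := one_add_pow_ne_zero hq (n + 1)
      rw [Finset.sum_range_succ, ← ih, pochQuotOne]
      field_simp
      linear_combination h
  | succ i ih =>
    have hs := summable_pochQuotOne hq (i + 1)
    convert hs.hasSum using 1
    have h₁ := ih.summable.tsum_eq_zero_add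
    have h₂ := hs.tsum_eq_zero_add
    rw [ih.tsum_eq] at h₁
    have h₃ : HasSum (fun M => q ^ (i + 1) * (pochQuotOne q M * (q ^ (i + 1)) ^ M
        + pochQuotOne q M * (q ^ (i + 1 + 1)) ^ M)) _ := (ih.add hs.hasSum).mul_left _
    have h₄ := ((summable_nat_add_iff 1).mpr ih.summable).tsum_sub
      ((summable_nat_add_iff 1).mpr hs)
    have h₅ : ∀ M, pochQuotOne q (M + 1) * (q ^ (i + 1)) ^ (M + 1)
        - pochQuotOne q (M + 1) * (q ^ (i + 1 + 1)) ^ (M + 1)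
        = q ^ (i + 1) * (pochQuotOne q M * (q ^ (i + 1)) ^ M
        + pochQuotOne q M * (q ^ (i + 1 + 1)) ^ M) := fun M => by
      linear_combination (q ^ (i + 1)) ^ (M + 1) * pochQuotOne_succ hq M
    simp only [h₅, h₃.tsum_eq] at h₄
    have h₆ := pochQuot_succ hq i
    have h₇ := pochQuot_ne_zero hq i
    have h₈ := pochQuot_ne_zero hq (i + 1)
    set A := poch (-q) q / poch q q
    set B := ∑' M, pochQuotOne q M * (q ^ (i + 1 + 1)) ^ M
    have hAB : A / pochQuot q i * (1 - q ^ (i + 1)) = B * (1 + q ^ (i + 1)) := by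
      simp only [pow_zero] at h₁ h₂
      linear_combination h₁ - h₂ - h₄
    rw [div_mul_eq_mul_div, div_eq_iff h₇] at hAB
    rw [div_eq_iff h₈]
    refine mul_right_cancel₀ (one_sub_pow_ne_zero hq i) ?_
    linear_combination hAB - B * h₆

/-- The generating function of the overpartitions of rank `-m`. -/
lemma hasSum_rankTerm_diag (m : ℕ) : HasSum (fun N => q * rankTerm q N (N + m))
    (∑' k : ℕ, poch (-q) q / poch q q * (-1) ^ k * (q ^ (k + 1)) ^ (k + 1 + m)
      * ((1 - q ^ (k + 1)) / (1 + q ^ (k + 1)))) := by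
  obtain ⟨C, hC⟩ := exists_norm_pochQuot_le hq
  have hC0 : 0 ≤ C := (norm_nonneg _).trans (hC 0).1
  have hgeom := summable_geometric_of_lt_one (norm_nonneg q) hq
  set F : ℕ × ℕ → ℂ := fun p => q * ((-1) ^ p.1 * pochQuot q p.1 * pochQuotOne q p.2
    * q ^ (p.1 + p.2 + (p.1 + 1) * (p.1 + p.2 + m))) with hF
  have hsum : Summable F := by
    refine Summable.of_norm_bounded (((hgeom.mul_of_nonneg hgeom
      (fun _ => by positivity) fun _ => by positivity).mul_left (C * C))) fun p => ?_
    rw [hF, norm_mul, norm_mul, norm_mul, norm_mul, norm_pow (-1 : ℂ), norm_neg, norm_one,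
      one_pow, one_mul, ← pow_add]
    refine (mul_le_of_le_one_left (by positivity) hq.le).trans ?_
    gcongr
    exacts [(hC _).1, (hC _).2, norm_pow_le_pow hq (by omega)]
  have hanti : HasSum (fun N => q * rankTerm q N (N + m)) (∑' p, F p) := by
    have h := (Finset.HasAntidiagonal.sigmaAntidiagonalEquivProd.hasSum_iff.mpr hsum.hasSum).sigma
      fun N => hasSum_fintype _
    convert h using 2 with N
    rw [rankTerm_eq_sum hq, Finset.mul_sum, ← Finset.sum_coe_sort]
    refine Finset.sum_congr rfl fun p _ => ?_
    simp only [hF, Function.comp_apply,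
      Finset.HasAntidiagonal.sigmaAntidiagonalEquivProd_apply,
      Finset.HasAntidiagonal.mem_antidiagonal.mp p.2]
  convert hanti using 1
  rw [hsum.tsum_prod]
  refine tsum_congr fun k => ?_
  have h₆ := pochQuot_succ hq k
  have h₈ := pochQuot_ne_zero hq (k + 1)
  have h₉ := one_add_pow_ne_zero hq (k + 1)
  have h := (hasSum_pochQuotOne hq (k + 1)).mul_left
    ((-1) ^ k * pochQuot q k * q ^ (k + 1 + (k + 1) * (k + m)))
  have h' : (fun M => F (k, M)) = fun M => (-1) ^ k * pochQuot q k * q ^ (k + 1 + (k + 1) * (k + m))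
      * (pochQuotOne q M * (q ^ (k + 1 + 1)) ^ M) := by
    funext M
    simp only [hF]
    ring
  have h₁₀ : poch (-q) q / poch q q * ((1 - q ^ (k + 1)) / (1 + q ^ (k + 1)))
      = pochQuot q k * (poch (-q) q / poch q q / pochQuot q (k + 1)) := by
    rw [← mul_div_assoc, ← mul_div_assoc, div_eq_div_iff h₉ h₈]
    linear_combination poch (-q) q / poch q q * h₆
  rw [h', h.tsum_eq]
  linear_combination (-1) ^ k * (q ^ (k + 1)) ^ (k + 1 + m) * h₁₀

/-- The total weight of the ranks `m` and `-m`. -/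
noncomputable def foldWeight (φ : ℤ → ℂ) (m : ℕ) : ℂ := if m = 0 then φ 0 else φ m + φ (-m)

omit hq in
lemma norm_foldWeight_le {φ : ℤ → ℂ} {B : ℝ} (hφ : ∀ r, ‖φ r‖ ≤ B) (m : ℕ) :
    ‖foldWeight φ m‖ ≤ 2 * B := by
  have hB : 0 ≤ B := (norm_nonneg _).trans (hφ 0)
  unfold foldWeight
  split_ifs
  · linarith [hφ 0]
  · exact (norm_add_le _ _).trans (by linarith [hφ m, hφ (-m)])

lemma summable_foldWeight {φ : ℤ → ℂ} {B : ℝ} (hφ : ∀ r, ‖φ r‖ ≤ B) (k : ℕ) :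
    Summable fun m => foldWeight φ m * (q ^ (k + 1)) ^ m := by
  refine Summable.of_norm_bounded
    ((summable_geometric_of_lt_one (norm_nonneg _) (norm_pow_lt_one hq k)).mul_left (2 * B))
    fun m => ?_
  rw [norm_mul, norm_pow]
  gcongr
  exact norm_foldWeight_le hφ m

lemma summable_weight_rankTerm {φ : ℤ → ℂ} {B : ℝ} (hφ : ∀ r, ‖φ r‖ ≤ B) :
    Summable fun p : ℕ × ℕ => φ ((p.1 : ℤ) - p.2) * (q * rankTerm q p.1 p.2) := by
  refine Summable.of_norm_bounded ((summable_rankTerm hq).mul_left (B * ‖q‖)) fun p => ?_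
  rw [norm_mul, norm_mul, mul_assoc]
  gcongr
  exact hφ _

lemma tsum_weight_eq_tsum_foldWeight {φ : ℤ → ℂ} {B : ℝ} (hφ : ∀ r, ‖φ r‖ ≤ B) :
    ∑' p : ℕ × ℕ, φ ((p.1 : ℤ) - p.2) * (q * rankTerm q p.1 p.2)
      = ∑' p : ℕ × ℕ, foldWeight φ p.1 * (q * rankTerm q p.2 (p.2 + p.1)) := by
  set f : ℕ × ℕ → ℂ := fun p => φ ((p.1 : ℤ) - p.2) * (q * rankTerm q p.1 p.2) with hf
  have hs : Summable f := summable_weight_rankTerm hq hφ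
  have h₁ := hs.indicator {p | p.1 ≤ p.2}
  have h₂ := hs.indicator {p | p.1 ≤ p.2}ᶜ
  set h : ℕ × ℕ → ℂ := fun p =>
    if p.1 ≤ p.2 then foldWeight φ (p.2 - p.1) * (q * rankTerm q p.1 p.2) else 0 with hh
  have hfold : ∀ p, {p : ℕ × ℕ | p.1 ≤ p.2}.indicator f p
      + {p : ℕ × ℕ | p.1 ≤ p.2}ᶜ.indicator f p.swap = h p := by
    rintro ⟨N, j⟩
    rcases lt_trichotomy N j with hlt | rfl | hlt
    · obtain ⟨m, rfl⟩ := Nat.exists_eq_add_of_lt hlt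
      have hm : ((N : ℤ) - ((N + m + 1 : ℕ) : ℤ)) = -((m + 1 : ℕ) : ℤ) := by push_cast; ring
      have hm' : (((N + m + 1 : ℕ) : ℤ) - (N : ℤ)) = ((m + 1 : ℕ) : ℤ) := by push_cast; ring
      have hsub : N + m + 1 - N = m + 1 := by omega
      simp only [hf, hh, Set.indicator, Set.mem_ofPred_eq, Set.mem_compl_iff, Prod.swap_prod_mk,
        hlt.le, hlt.not_ge, if_true, not_false_eq_true, foldWeight, hsub, hm, hm',
        rankTerm_comm q (N + m + 1) N, m.succ_ne_zero, if_false]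
      ring
    · simp [hf, hh, foldWeight]
    · simp [hh, hlt.le, hlt.not_ge]
  have hsum : ∑' p, f p = ∑' p, h p := by
    have hadd := h₁.tsum_add ((Equiv.prodComm ℕ ℕ).summable_iff.mpr h₂)
    have hswap : ∑' p, ({p : ℕ × ℕ | p.1 ≤ p.2}ᶜ.indicator f ∘ Equiv.prodComm ℕ ℕ) p
        = ∑' p, {p : ℕ × ℕ | p.1 ≤ p.2}ᶜ.indicator f p := (Equiv.prodComm ℕ ℕ).tsum_eq _
    rw [hswap, ← h₁.tsum_add h₂] at hadd
    refine Eq.trans ?_ (hadd.symm.trans (tsum_congr hfold))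
    exact tsum_congr fun p => (congrFun (Set.indicator_self_add_compl _ f) p).symm
  have hinj : Function.Injective fun p : ℕ × ℕ => (p.2, p.2 + p.1) := by
    rintro ⟨m, N⟩ ⟨m', N'⟩ h
    simp only [Prod.mk.injEq] at h ⊢
    omega
  rw [hsum, ← hinj.tsum_eq]
  · exact tsum_congr fun p => by simp [hh]
  · rintro ⟨N, j⟩ hp
    have hle : N ≤ j := by
      by_contra hlt
      simp [hh, hlt] at hp
    exact ⟨(j - N, N), by simp [hle]⟩

/-- Sums over all overpartitions of a weight depending on the rank, as Appell-type series. -/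
lemma tsum_weight_rankTerm {φ : ℤ → ℂ} {B : ℝ} (hφ : ∀ r, ‖φ r‖ ≤ B) {ω : ℕ → ℂ}
    (hω : ∀ k, HasSum (fun m => foldWeight φ m * (q ^ (k + 1)) ^ m) (ω k)) :
    ∑' p : ℕ × ℕ, φ ((p.1 : ℤ) - p.2) * (q * rankTerm q p.1 p.2)
      = poch (-q) q / poch q q * ∑' k : ℕ, (-1) ^ k * (q ^ (k + 1)) ^ (k + 1)
        * ((1 - q ^ (k + 1)) / (1 + q ^ (k + 1))) * ω k := by
  have hB : 0 ≤ B := (norm_nonneg _).trans (hφ 0)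
  set P := poch (-q) q / poch q q
  have hinj : Function.Injective fun p : ℕ × ℕ => (p.2, p.2 + p.1) := by
    rintro ⟨m, N⟩ ⟨m', N'⟩ h
    simp only [Prod.mk.injEq] at h ⊢
    omega
  have hsum : Summable fun p : ℕ × ℕ => foldWeight φ p.1 * (q * rankTerm q p.2 (p.2 + p.1)) := by
    refine Summable.of_norm_bounded
      (((summable_rankTerm hq).comp_injective hinj).mul_left (2 * B * ‖q‖)) fun p => ?_
    rw [norm_mul, norm_mul, mul_assoc (2 * B)]
    gcongr
    exacts [norm_foldWeight_le hφ _, le_rfl]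
  have hgeom := summable_geometric_of_lt_one (norm_nonneg q) hq
  obtain ⟨D, hD⟩ : ∃ D : ℝ, ∀ k : ℕ, ‖(1 - q ^ (k + 1)) / (1 + q ^ (k + 1))‖ ≤ D := by
    have hlim : Tendsto (fun k : ℕ => (1 - q ^ (k + 1)) / (1 + q ^ (k + 1))) atTop
        (𝓝 ((1 - 0) / (1 + 0))) := by
      have h := (tendsto_add_atTop_iff_nat 1).mpr (tendsto_pow_atTop_nhds_zero_of_norm_lt_one hq)
      exact (h.const_sub 1).div (h.const_add 1) (by simp)
    obtain ⟨D, hD⟩ := (Metric.isBounded_range_of_tendsto _ hlim).exists_norm_le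
    exact ⟨D, fun k => hD _ ⟨k, rfl⟩⟩
  set T : ℕ → ℕ → ℂ := fun m k => foldWeight φ m * (P * (-1) ^ k * (q ^ (k + 1)) ^ (k + 1 + m)
    * ((1 - q ^ (k + 1)) / (1 + q ^ (k + 1)))) with hT
  have hTs : Summable (Function.uncurry T) := by
    refine Summable.of_norm_bounded ((hgeom.mul_of_nonneg hgeom (fun _ => by positivity)
      fun _ => by positivity).mul_left (2 * B * ‖P‖ * D)) fun ⟨m, k⟩ => ?_
    have hle : ‖(q ^ (k + 1)) ^ (k + 1 + m)‖ ≤ ‖q‖ ^ m * ‖q‖ ^ k := by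
      rw [← pow_mul, ← pow_add]
      exact norm_pow_le_pow hq (by nlinarith)
    simp only [hT, Function.uncurry]
    rw [norm_mul, norm_mul, norm_mul, norm_mul, norm_pow (-1 : ℂ), norm_neg, norm_one, one_pow,
      mul_one]
    calc _ ≤ 2 * B * (‖P‖ * (‖q‖ ^ m * ‖q‖ ^ k) * D) := by
          gcongr
          exacts [norm_foldWeight_le hφ _, hD k]
      _ = _ := by ring
  rw [tsum_weight_eq_tsum_foldWeight hq hφ, hsum.tsum_prod]
  calc _ = ∑' m, ∑' k, T m k := tsum_congr fun m =>
        (tsum_mul_left.trans (by rw [(hasSum_rankTerm_diag hq m).tsum_eq])).trans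
          tsum_mul_left.symm
    _ = ∑' k, ∑' m, T m k := hTs.tsum_comm.symm
    _ = _ := by
        rw [← tsum_mul_left]
        refine tsum_congr fun k => ?_
        rw [← (hω k).tsum_eq, ← tsum_mul_left, ← tsum_mul_left]
        refine tsum_congr fun m => ?_
        simp only [hT]
        ring

/-- The weight of a rank in `Nbar 0 n + Nbar 1 n - Nbar 2 n - Nbar 3 n`. -/
noncomputable def rankWeight (r : ℤ) : ℂ :=
  if r % 6 = 0 ∨ r % 6 = 1 then 1 else if r % 6 = 2 ∨ r % 6 = 3 then -1 else 0

omit hq in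
lemma norm_rankWeight_le (r : ℤ) : ‖rankWeight r‖ ≤ 1 := by
  unfold rankWeight
  split_ifs <;> simp

omit hq in
lemma foldWeight_rankWeight_add_three (m : ℕ) : foldWeight rankWeight (m + 3)
    = foldWeight rankWeight (m + 2) - foldWeight rankWeight (m + 1) := by
  simp only [foldWeight, Nat.add_eq_zero_iff, OfNat.ofNat_ne_zero, one_ne_zero, and_false,
    if_false, rankWeight]
  push_cast
  have h : (m : ℤ) % 6 = 0 ∨ (m : ℤ) % 6 = 1 ∨ (m : ℤ) % 6 = 2 ∨ (m : ℤ) % 6 = 3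
      ∨ (m : ℤ) % 6 = 4 ∨ (m : ℤ) % 6 = 5 := by omega
  obtain ⟨t, ht⟩ : ∃ t : ℤ, (m : ℤ) = 6 * t + (m : ℤ) % 6 := ⟨(m : ℤ) / 6, by omega⟩
  rw [ht]
  have hmod : ∀ a : ℤ, (6 * t + a) % 6 = a % 6 := fun a => by omega
  have hneg : ∀ a : ℤ, (-(6 * t + a)) % 6 = (-a) % 6 := fun a => by omega
  simp only [add_assoc, hmod, hneg]
  rcases h with h | h | h | h | h | h <;> rw [h] <;> norm_num

lemma one_sub_add_sq_ne_zero (k : ℕ) : 1 - q ^ (k + 1) + (q ^ (k + 1)) ^ 2 ≠ 0 := by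
  intro h
  apply one_add_pow_succ_ne_zero hq (3 * k + 2)
  linear_combination (1 + q ^ (k + 1)) * h

lemma hasSum_foldWeight_rankWeight (k : ℕ) :
    HasSum (fun m => foldWeight rankWeight m * (q ^ (k + 1)) ^ m)
      ((1 - (q ^ (k + 1)) ^ 2) / (1 - q ^ (k + 1) + (q ^ (k + 1)) ^ 2)) := by
  have h₀ := one_sub_add_sq_ne_zero hq k
  have hs := summable_foldWeight hq norm_rankWeight_le k
  convert hs.hasSum using 1
  set Q := q ^ (k + 1)
  have h₁ := hs.sum_add_tsum_nat_add 1
  have h₂ := hs.sum_add_tsum_nat_add 2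
  have h₃ := hs.sum_add_tsum_nat_add 3
  have hrec : ∑' m, foldWeight rankWeight (m + 3) * Q ^ (m + 3)
      = Q * (∑' m, foldWeight rankWeight (m + 2) * Q ^ (m + 2))
        - Q ^ 2 * ∑' m, foldWeight rankWeight (m + 1) * Q ^ (m + 1) := by
    rw [← tsum_mul_left, ← tsum_mul_left, ← Summable.tsum_sub
      (((summable_nat_add_iff 2).mpr hs).mul_left _) (((summable_nat_add_iff 1).mpr hs).mul_left _)]
    refine tsum_congr fun m => ?_
    rw [foldWeight_rankWeight_add_three]
    ring
  have w₀ : foldWeight rankWeight 0 = 1 := by norm_num [foldWeight, rankWeight]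
  have w₁ : foldWeight rankWeight 1 = 1 := by norm_num [foldWeight, rankWeight]
  have w₂ : foldWeight rankWeight 2 = -1 := by norm_num [foldWeight, rankWeight]
  simp only [Finset.sum_range_succ, Finset.sum_range_zero, w₀, w₁, w₂] at h₁ h₂ h₃
  rw [div_eq_iff h₀]
  linear_combination h₃ - hrec - Q * h₂ + Q ^ 2 * h₁

lemma hasSum_foldWeight_one (k : ℕ) :
    HasSum (fun m => foldWeight (fun _ => 1) m * (q ^ (k + 1)) ^ m)
      ((1 + q ^ (k + 1)) / (1 - q ^ (k + 1))) := by
  have h₀ := one_sub_pow_ne_zero hq k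
  have h := (hasSum_geometric_of_norm_lt_one (norm_pow_lt_one hq k)).mul_left (2 * q ^ (k + 1))
  have e₁ : (fun m => foldWeight (fun _ => 1) (m + 1) * (q ^ (k + 1)) ^ (m + 1))
      = fun m => 2 * q ^ (k + 1) * (q ^ (k + 1)) ^ m := by
    funext m
    simp only [foldWeight, m.succ_ne_zero, if_false]
    ring
  have e₂ : (1 + q ^ (k + 1)) / (1 - q ^ (k + 1))
      - ∑ m ∈ Finset.range 1, foldWeight (fun _ => 1) m * (q ^ (k + 1)) ^ m
      = 2 * q ^ (k + 1) * (1 - q ^ (k + 1))⁻¹ := by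
    simp only [Finset.sum_range_one, foldWeight, if_true, pow_zero]
    field_simp
    ring
  rw [← hasSum_nat_add_iff' 1, e₁, e₂]
  exact h

lemma summable_rankTerm_right (N : ℕ) : Summable fun j => rankTerm q N j :=
  (summable_rankTerm hq).of_norm.prod_factor N

lemma tsum_rankTerm_right (N : ℕ) :
    2 * q * ∑' j, rankTerm q N j = pochQuotOne q (N + 1) * q ^ (N + 1) := by
  induction N with
  | zero =>
    have h := pochQuotOne_succ hq 0
    have h₀ := one_sub_pow_ne_zero hq 0
    simp only [rankTerm_zero_left, tsum_geometric_of_norm_lt_one hq]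
    rw [pochQuotOne_zero] at h
    simp only [zero_add, pow_one, pow_zero] at h h₀ ⊢
    rw [eq_div_iff h₀ |>.mpr h]
    field_simp
    ring
  | succ N ih =>
    have hs := summable_rankTerm_right hq
    have h₁ := (hs (N + 1)).tsum_eq_zero_add
    have h₂ := (hs N).tsum_eq_zero_add
    simp only [rankTerm_succ_succ, rankTerm_zero_right] at h₁ h₂
    rw [Summable.tsum_add (((hs (N + 1)).mul_left _).add
        (((summable_nat_add_iff 1).mpr (hs N)).mul_left _)) ((hs N).mul_left _),
      Summable.tsum_add ((hs (N + 1)).mul_left _)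
        (((summable_nat_add_iff 1).mpr (hs N)).mul_left _),
      tsum_mul_left, tsum_mul_left, tsum_mul_left] at h₁
    refine mul_right_cancel₀ (one_sub_pow_ne_zero hq (N + 1)) ?_
    linear_combination 2 * q * h₁ - 2 * q ^ 2 * h₂ + q * (1 + q ^ (N + 1)) * ih
      - q ^ (N + 2) * pochQuotOne_succ hq (N + 1)

/-- The generating function of all nonempty overpartitions. -/
lemma tsum_rankTerm :
    2 * ∑' p : ℕ × ℕ, q * rankTerm q p.1 p.2 = poch (-q) q / poch q q - 1 := by
  have h := hasSum_pochQuotOne hq 0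
  have h₁ := h.summable.tsum_eq_zero_add
  rw [h.tsum_eq, pochQuot_zero, div_one] at h₁
  rw [((summable_rankTerm hq).of_norm.mul_left q).tsum_prod, ← tsum_mul_left, h₁]
  simp only [tsum_mul_left, ← mul_assoc, tsum_rankTerm_right hq, zero_add, pow_one,
    pochQuotOne_zero, pow_zero, one_mul, add_sub_cancel_left]

lemma summable_theta_mul {c : ℂ → ℂ} (hc : ContinuousAt c 0) :
    Summable fun k : ℕ => (-1) ^ k * (q ^ (k + 1)) ^ (k + 1) * c (q ^ (k + 1)) := by
  have hlim : Tendsto (fun k : ℕ => c (q ^ (k + 1))) atTop (𝓝 (c 0)) :=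
    hc.tendsto.comp
      ((tendsto_add_atTop_iff_nat 1).mpr (tendsto_pow_atTop_nhds_zero_of_norm_lt_one hq))
  obtain ⟨D, hD⟩ := (Metric.isBounded_range_of_tendsto _ hlim).exists_norm_le
  refine Summable.of_norm_bounded
    ((summable_geometric_of_lt_one (norm_nonneg q) hq).mul_right D) fun k => ?_
  rw [norm_mul, norm_mul, norm_pow (-1 : ℂ), norm_neg, norm_one, one_pow, one_mul, ← pow_mul]
  gcongr
  exacts [norm_pow_le_pow hq (by nlinarith), hD _ ⟨k, rfl⟩]

lemma tsum_appell (hq0 : q ≠ 0) :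
    ∑' n : ℤ, (-1 : ℂ) ^ n * q ^ ((n : ℤ) ^ 2 + n) / (1 + q ^ (3 * n))
      = 1 / 2 - ∑' k : ℕ, (-1) ^ k * (q ^ (k + 1)) ^ (k + 1)
        * ((q ^ (k + 1) + (q ^ (k + 1)) ^ 2) / (1 + (q ^ (k + 1)) ^ 3)) := by
  set f : ℤ → ℂ := fun n => (-1 : ℂ) ^ n * q ^ ((n : ℤ) ^ 2 + n) / (1 + q ^ (3 * n)) with hf
  have h₁ : ∀ k : ℕ, f (k + 1 : ℕ) = -((-1) ^ k * (q ^ (k + 1)) ^ (k + 1)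
      * (q ^ (k + 1) / (1 + (q ^ (k + 1)) ^ 3))) := fun k => by
    have e₁ : ((k + 1 : ℕ) : ℤ) ^ 2 + (k + 1 : ℕ) = (((k + 1) ^ 2 + (k + 1) : ℕ) : ℤ) := by
      push_cast; ring
    have e₂ : 3 * ((k + 1 : ℕ) : ℤ) = ((3 * (k + 1) : ℕ) : ℤ) := by push_cast; ring
    simp only [hf]
    rw [e₁, e₂, zpow_natCast, zpow_natCast, zpow_natCast]
    ring
  have h₂ : ∀ k : ℕ, f (-(k + 1)) = -((-1) ^ k * (q ^ (k + 1)) ^ (k + 1)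
      * ((q ^ (k + 1)) ^ 2 / (1 + (q ^ (k + 1)) ^ 3))) := fun k => by
    have e₀ : (-((k : ℤ) + 1)) = -((k + 1 : ℕ) : ℤ) := by push_cast; ring
    have e₁ : (-((k + 1 : ℕ) : ℤ)) ^ 2 + -((k + 1 : ℕ) : ℤ) = (((k + 1) * k : ℕ) : ℤ) := by
      push_cast; ring
    have e₂ : 3 * (-((k + 1 : ℕ) : ℤ)) = -((3 * (k + 1) : ℕ) : ℤ) := by push_cast; ring
    have e₃ : (-1 : ℂ) ^ (-((k + 1 : ℕ) : ℤ)) = -(-1) ^ k := by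
      rw [zpow_neg, zpow_natCast, ← inv_pow, inv_neg, inv_one, pow_succ]
      ring
    have e₄ := one_add_pow_ne_zero hq (3 * (k + 1))
    have e₅ : q ^ (3 * (k + 1)) ≠ 0 := pow_ne_zero _ hq0
    have e₆ : 1 + (q ^ (3 * (k + 1)))⁻¹ = (1 + q ^ (3 * (k + 1))) / q ^ (3 * (k + 1)) := by
      field_simp
      ring
    simp only [hf]
    rw [e₀, e₁, e₂, e₃, zpow_natCast, zpow_neg, zpow_natCast, e₆, ← pow_mul q (k + 1) 3,
      mul_comm (k + 1) 3, div_div_eq_mul_div, ← mul_div_assoc, ← neg_div]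
    congr 1
    ring
  have hc₁ : ContinuousAt (fun Q : ℂ => Q / (1 + Q ^ 3)) 0 := by
    fun_prop (disch := simp)
  have hc₂ : ContinuousAt (fun Q : ℂ => Q ^ 2 / (1 + Q ^ 3)) 0 := by
    fun_prop (disch := simp)
  have s₁ := summable_theta_mul hq hc₁
  have s₂ := summable_theta_mul hq hc₂
  have sf₁ : Summable fun n : ℕ => f n := by
    rw [← summable_nat_add_iff 1]
    simpa only [h₁] using s₁.neg
  have sf₂ : Summable fun n : ℕ => f (-(n + 1)) := by
    simpa only [h₂] using s₂.neg
  rw [tsum_of_nat_of_neg_add_one sf₁ sf₂, sf₁.tsum_eq_zero_add]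
  simp only [h₁, h₂, tsum_neg, add_div, mul_add, s₁.tsum_add s₂]
  norm_num [hf]
  ring

/-- The Appell-type series as a sum over all overpartitions. -/
lemma appell_eq_tsum_rankWeight (hq0 : q ≠ 0) :
    1 + 2 * ∑' p : ℕ × ℕ, rankWeight ((p.1 : ℤ) - p.2) * (q * rankTerm q p.1 p.2)
      = 2 * poch (-q) q / poch q q
          * (∑' n : ℤ, (-1 : ℂ) ^ n * q ^ ((n : ℤ) ^ 2 + n) / (1 + q ^ (3 * n))) := by
  have h₁ := tsum_weight_rankTerm hq (φ := fun _ => 1) (B := 1) (by simp)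
    (hasSum_foldWeight_one hq)
  simp only [one_mul] at h₁
  have h₂ := tsum_rankTerm hq
  have hc₁ : ContinuousAt (fun Q : ℂ => (1 - Q) / (1 + Q) * ((1 + Q) / (1 - Q))) 0 := by
    fun_prop (disch := simp)
  have hc₂ : ContinuousAt (fun Q : ℂ => (Q + Q ^ 2) / (1 + Q ^ 3)) 0 := by
    fun_prop (disch := simp)
  have h₃ := (summable_theta_mul hq hc₁).tsum_sub (summable_theta_mul hq hc₂)
  rw [tsum_appell hq hq0, tsum_weight_rankTerm hq norm_rankWeight_le
    (hasSum_foldWeight_rankWeight hq)]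
  have h₄ : ∀ k : ℕ, (-1) ^ k * (q ^ (k + 1)) ^ (k + 1)
      * ((1 - q ^ (k + 1)) / (1 + q ^ (k + 1)))
      * ((1 - (q ^ (k + 1)) ^ 2) / (1 - q ^ (k + 1) + (q ^ (k + 1)) ^ 2))
      = (-1) ^ k * (q ^ (k + 1)) ^ (k + 1)
          * ((1 - q ^ (k + 1)) / (1 + q ^ (k + 1)) * ((1 + q ^ (k + 1)) / (1 - q ^ (k + 1))))
        - (-1) ^ k * (q ^ (k + 1)) ^ (k + 1)
          * ((q ^ (k + 1) + (q ^ (k + 1)) ^ 2) / (1 + (q ^ (k + 1)) ^ 3)) := fun k => by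
    have n₁ := one_sub_pow_ne_zero hq k
    have n₂ := one_add_pow_succ_ne_zero hq k
    have n₃ := one_sub_add_sq_ne_zero hq k
    have n₄ : 1 + (q ^ (k + 1)) ^ 3 = (1 + q ^ (k + 1)) * (1 - q ^ (k + 1) + (q ^ (k + 1)) ^ 2) := by
      ring
    rw [n₄, mul_assoc, ← mul_sub]
    congr 1
    generalize q ^ (k + 1) = Q at *
    field_simp
    ring
  simp only [mul_assoc] at h₁ h₃ h₄ ⊢
  simp only [h₄]
  rw [h₃]
  rw [h₁] at h₂
  linear_combination h₂

end

/-- The pairs of a multiset of parts and a set of overlined part sizes that are overpartitions. -/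
def IsOverpartition (p : Multiset ℕ × Finset ℕ) : Prop := 0 ∉ p.1 ∧ p.2 ⊆ p.1.toFinset

/-- The overpartitions with parts at most `N` and exactly `j` parts. -/
def overBox : ℕ → ℕ → Finset (Multiset ℕ × Finset ℕ)
  | _, 0 => {(0, ∅)}
  | 0, _ + 1 => ∅
  | N + 1, j + 1 => overBox N (j + 1) ∪ ((overBox (N + 1) j).image (Prod.map ((N + 1) ::ₘ ·) id)
      ∪ (overBox N j).image (Prod.map ((N + 1) ::ₘ ·) (insert (N + 1))))

lemma overBox_zero_right (N : ℕ) : overBox N 0 = {(0, ∅)} := by rw [overBox]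

lemma overBox_zero_succ (j : ℕ) : overBox 0 (j + 1) = ∅ := by rw [overBox]

lemma overBox_succ_succ (N j : ℕ) : overBox (N + 1) (j + 1) =
    overBox N (j + 1) ∪ ((overBox (N + 1) j).image (Prod.map ((N + 1) ::ₘ ·) id)
      ∪ (overBox N j).image (Prod.map ((N + 1) ::ₘ ·) (insert (N + 1)))) := by
  rw [overBox]

lemma mem_overBox {N j : ℕ} {p : Multiset ℕ × Finset ℕ} :
    p ∈ overBox N j ↔ IsOverpartition p ∧ (∀ i ∈ p.1, i ≤ N) ∧ p.1.card = j := by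
  induction N generalizing j p with
  | zero =>
    obtain ⟨r, s⟩ := p
    cases j with
    | zero =>
      rw [overBox_zero_right, Finset.mem_singleton, Prod.mk.injEq, IsOverpartition]
      constructor
      · rintro ⟨rfl, rfl⟩
        simp
      · rintro ⟨⟨-, hs⟩, -, hr⟩
        obtain rfl := Multiset.card_eq_zero.mp hr
        exact ⟨rfl, by simpa using hs⟩
    | succ j =>
      rw [overBox_zero_succ]
      refine iff_of_false (Finset.notMem_empty _) ?_
      rintro ⟨⟨h0, -⟩, hle, hr⟩
      obtain ⟨i, hi⟩ := Multiset.card_pos_iff_exists_mem.mp (j.succ_pos.trans_eq hr.symm)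
      exact h0 (Nat.le_zero.mp (hle i hi) ▸ hi)
  | succ N ihN =>
    induction j generalizing p with
    | zero =>
      obtain ⟨r, s⟩ := p
      rw [overBox_zero_right, Finset.mem_singleton, Prod.mk.injEq, IsOverpartition]
      constructor
      · rintro ⟨rfl, rfl⟩
        simp
      · rintro ⟨⟨-, hs⟩, -, hr⟩
        obtain rfl := Multiset.card_eq_zero.mp hr
        exact ⟨rfl, by simpa using hs⟩
    | succ j ihj =>
      simp only [overBox_succ_succ, Finset.mem_union, Finset.mem_image, ihN, ihj]
      constructor
      · rintro (⟨hp, hle, hr⟩ | ⟨⟨r, s⟩, ⟨⟨h0, hs⟩, hle, hr⟩, rfl⟩ |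
          ⟨⟨r, s⟩, ⟨⟨h0, hs⟩, hle, hr⟩, rfl⟩)
        · exact ⟨hp, fun i hi => (hle i hi).trans N.le_succ, hr⟩
        · refine ⟨⟨by simpa using h0, ?_⟩, ?_, by simpa using hr⟩
          · simpa using hs.trans (Finset.subset_insert _ _)
          · simpa using hle
        · refine ⟨⟨by simpa using h0, ?_⟩, ?_, by simpa using hr⟩
          · simpa using Finset.insert_subset_insert _ hs
          · simpa using fun i hi => (hle i hi).trans N.le_succ
      · obtain ⟨r, s⟩ := p
        rintro ⟨⟨h0, hs⟩, hle, hr⟩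
        by_cases hN : N + 1 ∈ r
        · right
          obtain ⟨r, rfl⟩ := Multiset.exists_cons_of_mem hN
          simp only [Multiset.mem_cons, not_or, Multiset.card_cons, add_left_inj,
            Multiset.toFinset_cons] at h0 hs hle hr
          by_cases hN' : N + 1 ∈ s ∧ N + 1 ∉ r
          · refine Or.inr ⟨(r, s.erase (N + 1)), ⟨⟨h0.2, ?_⟩, fun i hi => ?_, hr⟩, ?_⟩
            · exact Finset.subset_insert_iff.mp hs
            · have := hle i (Or.inr hi)
              have : i ≠ N + 1 := fun h => hN'.2 (h ▸ hi)
              omega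
            · simp [Prod.map, Finset.insert_erase hN'.1]
          · refine Or.inl ⟨(r, s), ⟨⟨h0.2, fun i hi => ?_⟩, fun i hi => hle i (Or.inr hi), hr⟩, rfl⟩
            rcases Finset.mem_insert.mp (hs hi) with rfl | h
            · simpa [hi] using hN'
            · exact h
        · refine Or.inl ⟨⟨h0, hs⟩, fun i hi => ?_, hr⟩
          have := hle i hi
          have : i ≠ N + 1 := fun h => hN (h ▸ hi)
          omega

lemma sum_overBox_succ_succ {R : Type*} [CommSemiring R] (q : R) (N j : ℕ) :
    ∑ p ∈ overBox (N + 1) (j + 1), q ^ p.1.sum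
      = ∑ p ∈ overBox N (j + 1), q ^ p.1.sum
        + q ^ (N + 1) * (∑ p ∈ overBox (N + 1) j, q ^ p.1.sum
          + ∑ p ∈ overBox N j, q ^ p.1.sum) := by
  have hnot : ∀ {j : ℕ} {p : Multiset ℕ × Finset ℕ}, p ∈ overBox N j → N + 1 ∉ p.1 :=
    fun hp h => by simpa using (mem_overBox.mp hp).2.1 _ h
  rw [overBox_succ_succ, Finset.sum_union, Finset.sum_union, Finset.sum_image, Finset.sum_image,
    mul_add, Finset.mul_sum, Finset.mul_sum]
  · simp [pow_add]
  · rintro ⟨r, s⟩ hp ⟨r', s'⟩ hp' h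
    have hs : N + 1 ∉ s := fun h => hnot hp (by simpa using (mem_overBox.mp hp).1.2 h)
    have hs' : N + 1 ∉ s' := fun h => hnot hp' (by simpa using (mem_overBox.mp hp').1.2 h)
    simp only [Prod.map_apply, Prod.mk.injEq, Multiset.cons_inj_right] at h ⊢
    exact ⟨h.1, by rw [← Finset.erase_insert hs, h.2, Finset.erase_insert hs']⟩
  · rintro ⟨r, s⟩ - ⟨r', s'⟩ - h
    simpa using h
  · simp only [Finset.disjoint_left, Finset.mem_image, not_exists, not_and]
    rintro _ ⟨⟨r, s⟩, hp, rfl⟩ ⟨r', s'⟩ hp' h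
    simp only [Prod.map_apply, Prod.mk.injEq, Multiset.cons_inj_right, id] at h
    obtain ⟨rfl, rfl⟩ := h
    exact hnot hp' (by simpa using (mem_overBox.mp hp).1.2 (Finset.mem_insert_self _ _))
  · simp only [Finset.disjoint_left, Finset.mem_union, Finset.mem_image]
    rintro p hp (⟨p', -, rfl⟩ | ⟨p', -, rfl⟩) <;> exact hnot hp (by simp)

lemma sum_overBox_eq_add (q : ℂ) (N j : ℕ) :
    ∑ p ∈ overBox (N + 1) (j + 1), q ^ p.1.sum
      = ∑ p ∈ overBox N (j + 1), q ^ p.1.sum + 2 * q * rankTerm q N j := by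
  induction N generalizing j with
  | zero =>
    induction j with
    | zero =>
      simp [sum_overBox_succ_succ, overBox_zero_right, overBox_zero_succ, rankTerm_zero_left]
      ring
    | succ j ihj =>
      rw [sum_overBox_succ_succ, ihj]
      simp only [overBox_zero_succ, Finset.sum_empty, rankTerm_zero_left]
      ring
  | succ N ihN =>
    induction j with
    | zero =>
      simp [sum_overBox_succ_succ q (N + 1), overBox_zero_right, rankTerm_zero_right]
      ring
    | succ j ihj =>
      linear_combination sum_overBox_succ_succ q (N + 1) (j + 1) + q ^ (N + 2) * (ihj + ihN j)
        - 2 * q * rankTerm_succ_succ q N j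
        - q * (sum_overBox_succ_succ q N (j + 1) - ihN (j + 1))

/-- The overpartitions with largest part `c.1 + 1` and `c.2 + 1` parts. -/
def overShape (c : ℕ × ℕ) : Finset (Multiset ℕ × Finset ℕ) :=
  overBox (c.1 + 1) (c.2 + 1) \ overBox c.1 (c.2 + 1)

lemma mem_overShape {c : ℕ × ℕ} {p : Multiset ℕ × Finset ℕ} : p ∈ overShape c ↔
    IsOverpartition p ∧ p.1.toFinset.sup id = c.1 + 1 ∧ p.1.card = c.2 + 1 := by
  have h : ∀ N, (∀ i ∈ p.1, i ≤ N) ↔ p.1.toFinset.sup id ≤ N := fun N => by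
    simp [Finset.sup_le_iff]
  rw [overShape, Finset.mem_sdiff, mem_overBox, mem_overBox, h, h]
  constructor
  · rintro ⟨⟨hp, hle, hr⟩, hnot⟩
    exact ⟨hp, le_antisymm hle (by by_contra hlt; exact hnot ⟨hp, by omega, hr⟩), hr⟩
  · rintro ⟨hp, hs, hr⟩
    exact ⟨⟨hp, hs.le, hr⟩, fun h' => by omega⟩

lemma sum_overShape (q : ℂ) (c : ℕ × ℕ) :
    ∑ p ∈ overShape c, q ^ p.1.sum = 2 * q * rankTerm q c.1 c.2 := by
  rw [overShape, Finset.sum_sdiff_eq_sub, sum_overBox_eq_add, add_sub_cancel_left]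
  rw [overBox_succ_succ]
  exact Finset.subset_union_left

/-- The overpartitions of `n`. -/
def overpartitions (n : ℕ) : Finset (Multiset ℕ × Finset ℕ) :=
  {p ∈ (Finset.range (n + 1)).biUnion (overBox n) | p.1.sum = n}

lemma mem_overpartitions {n : ℕ} {p : Multiset ℕ × Finset ℕ} :
    p ∈ overpartitions n ↔ IsOverpartition p ∧ p.1.sum = n := by
  simp only [overpartitions, Finset.mem_filter, Finset.mem_biUnion, Finset.mem_range, mem_overBox]
  constructor
  · rintro ⟨⟨j, -, hp, -⟩, hn⟩
    exact ⟨hp, hn⟩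
  · rintro ⟨hp, rfl⟩
    have hcard := Multiset.card_nsmul_le_sum (s := p.1) (a := 1)
      fun i hi => Nat.one_le_iff_ne_zero.mpr fun h => hp.1 (h ▸ hi)
    exact ⟨⟨p.1.card, by simpa [Nat.lt_succ_iff] using hcard, hp,
      fun i hi => Multiset.le_sum_of_mem hi, rfl⟩, rfl⟩

lemma Nbar_eq_card (s n : ℕ) :
    Nbar s n = ((overpartitions n).filter fun p => overRank p % 6 = (s : ℤ)).card := by
  rw [Nbar, ← Set.ncard_coe_finset]
  congr 1
  ext p
  simp only [Finset.coe_filter, Set.mem_ofPred_eq, mem_overpartitions, IsOverpartition]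
  tauto

lemma sum_rankWeight (n : ℕ) : ∑ p ∈ overpartitions n, rankWeight (overRank p)
    = (((Nbar 0 n : ℤ) + (Nbar 1 n : ℤ) - (Nbar 2 n : ℤ) - (Nbar 3 n : ℤ) : ℤ) : ℂ) := by
  have h : ∀ r : ℤ, rankWeight r = (if r % 6 = (0 : ℕ) then 1 else 0)
      + (if r % 6 = (1 : ℕ) then 1 else 0) - (if r % 6 = (2 : ℕ) then 1 else 0)
      - (if r % 6 = (3 : ℕ) then 1 else 0) := fun r => by
    unfold rankWeight
    split_ifs <;> first | omega | norm_num
  simp only [h, Finset.sum_add_distrib, Finset.sum_sub_distrib, Finset.sum_boole, Nbar_eq_card]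
  push_cast
  rfl

section

variable {α β E : Type*} [NormedAddCommGroup E] {F : α → E} {g : α → β} {T : β → Finset α}

lemma hasSum_fiber (hT : ∀ p, F p ≠ 0 → p ∈ T (g p)) (hg : ∀ c, ∀ p ∈ T c, g p = c) (c : β) :
    HasSum (fun p : {p // g p = c} => F p) (∑ p ∈ T c, F p) := by
  have h : HasSum ({p | g p = c}.indicator F) (∑ p ∈ T c, {p | g p = c}.indicator F p) := by
    refine hasSum_sum_of_ne_finset_zero fun p hp => ?_
    by_contra h0
    obtain ⟨rfl, hF⟩ := Set.indicator_apply_ne_zero.mp h0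
    exact hp (hT p hF)
  rw [Finset.sum_congr rfl fun p hp => Set.indicator_of_mem (s := {p | g p = c}) (hg c p hp) F] at h
  exact hasSum_subtype_iff_indicator.mpr h

lemma HasSum.sum_fiber {a : E} (hF : HasSum F a) (hT : ∀ p, F p ≠ 0 → p ∈ T (g p))
    (hg : ∀ c, ∀ p ∈ T c, g p = c) : HasSum (fun c => ∑ p ∈ T c, F p) a :=
  ((Equiv.sigmaFiberEquiv g).hasSum_iff.mpr hF).sigma (hasSum_fiber hT hg)

lemma summable_of_sum_fiber {F : α → ℝ} (h0 : ∀ p, 0 ≤ F p) (hT : ∀ p, F p ≠ 0 → p ∈ T (g p))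
    (hg : ∀ c, ∀ p ∈ T c, g p = c) (h : Summable fun c => ∑ p ∈ T c, F p) : Summable F := by
  refine (Equiv.sigmaFiberEquiv g).summable_iff.mp
    ((summable_sigma_of_nonneg fun _ => h0 _).mpr ⟨fun c => (hasSum_fiber hT hg c).summable, ?_⟩)
  exact h.congr fun c => (hasSum_fiber hT hg c).tsum_eq.symm

end

/-- For a nonempty overpartition, the `c` with `p ∈ overShape c`. -/
def shape (p : Multiset ℕ × Finset ℕ) : ℕ × ℕ := (p.1.toFinset.sup id - 1, p.1.card - 1)

lemma shape_eq {c : ℕ × ℕ} {p : Multiset ℕ × Finset ℕ} (hp : p ∈ overShape c) : shape p = c := by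
  obtain ⟨-, h₁, h₂⟩ := mem_overShape.mp hp
  simp [shape, h₁, h₂]

lemma mem_overShape_shape {p : Multiset ℕ × Finset ℕ} :
    p ∈ overShape (shape p) ↔ IsOverpartition p ∧ p ≠ (0, ∅) := by
  rw [mem_overShape, shape]
  refine and_congr_right fun hp => ⟨?_, fun h0 => ?_⟩
  · rintro h rfl
    simp at h
  · have h : p.1 ≠ 0 := fun h => h0 (Prod.ext h (by simpa [h] using hp.2))
    obtain ⟨i, hi⟩ := Multiset.exists_mem_of_ne_zero h
    have h₁ : i ≤ p.1.toFinset.sup id := Finset.le_sup (f := id) (Multiset.mem_toFinset.mpr hi)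
    have h₂ : i ≠ 0 := fun h => hp.1 (h ▸ hi)
    have h₃ := Multiset.card_pos.mpr h
    dsimp only
    omega

lemma overRank_eq {c : ℕ × ℕ} {p : Multiset ℕ × Finset ℕ} (hp : p ∈ overShape c) :
    overRank p = (c.1 : ℤ) - c.2 := by
  obtain ⟨-, h₁, h₂⟩ := mem_overShape.mp hp
  rw [overRank, h₁, h₂]
  push_cast
  ring

section

variable {q : ℂ} (hq : ‖q‖ < 1)
include hq

lemma summable_overShape :
    Summable fun p => if p ∈ overShape (shape p) then ‖q‖ ^ p.1.sum else 0 := by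
  refine summable_of_sum_fiber (g := shape) (T := overShape) (fun p => by positivity)
    (fun p hp => by by_contra h; simp [h] at hp) (fun c p hp => shape_eq hp) ?_
  have hq' : ‖(‖q‖ : ℂ)‖ < 1 := by simpa using hq
  refine ((summable_rankTerm hq').mul_left (2 * ‖q‖)).congr fun c => ?_
  have h := congrArg norm (sum_overShape (‖q‖ : ℂ) c)
  have h' : ∑ p ∈ overShape c, (‖q‖ : ℂ) ^ p.1.sum
      = ((∑ p ∈ overShape c, ‖q‖ ^ p.1.sum : ℝ) : ℂ) := by push_cast; rfl
  rw [h', Complex.norm_of_nonneg (Finset.sum_nonneg fun _ _ => by positivity)] at h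
  rw [Finset.sum_congr rfl fun p hp => if_pos (by rwa [shape_eq hp]), h]
  simp

open Classical in
/-- Summing over all overpartitions by largest part and number of parts. -/
lemma hasSum_isOverpartition {φ : ℤ → ℂ} {B : ℝ} (hφ : ∀ r, ‖φ r‖ ≤ B) :
    HasSum (fun p => if IsOverpartition p then φ (overRank p) * q ^ p.1.sum else 0)
      (φ 0 + 2 * ∑' c : ℕ × ℕ, φ ((c.1 : ℤ) - c.2) * (q * rankTerm q c.1 c.2)) := by
  set F : Multiset ℕ × Finset ℕ → ℂ :=
    fun p => if p ∈ overShape (shape p) then φ (overRank p) * q ^ p.1.sum else 0 with hF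
  have hs : Summable F := by
    refine Summable.of_norm_bounded ((summable_overShape hq).mul_left B) fun p => ?_
    simp only [hF]
    split_ifs
    · rw [norm_mul, norm_pow]
      gcongr
      exact hφ _
    · simp
  have h := hs.hasSum.sum_fiber (g := shape) (T := overShape)
    (fun p hp => by by_contra h; simp [hF, h] at hp) (fun c p hp => shape_eq hp)
  have hsum : ∀ c, ∑ p ∈ overShape c, F p
      = 2 * (φ ((c.1 : ℤ) - c.2) * (q * rankTerm q c.1 c.2)) := fun c => by
    rw [Finset.sum_congr rfl fun p hp => (if_pos (by rwa [shape_eq hp])).trans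
      (congrArg (φ · * q ^ p.1.sum) (overRank_eq hp)), ← Finset.mul_sum, sum_overShape]
    ring
  simp only [hsum] at h
  rw [← tsum_mul_left, h.tsum_eq]
  convert (hasSum_ite_eq ((0, ∅) : Multiset ℕ × Finset ℕ) (φ 0)).add hs.hasSum using 1
  funext p
  simp only [hF, mem_overShape_shape]
  by_cases hp : p = (0, ∅)
  · subst hp
    simp [IsOverpartition, overRank]
  · simp [hp]

lemma tsum_Nbar_eq_tsum_rankTerm :
    ∑' n : ℕ, (((Nbar 0 n : ℤ) + (Nbar 1 n : ℤ) - (Nbar 2 n : ℤ) - (Nbar 3 n : ℤ) : ℤ) : ℂ)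
        * q ^ n
      = 1 + 2 * ∑' c : ℕ × ℕ, rankWeight ((c.1 : ℤ) - c.2) * (q * rankTerm q c.1 c.2) := by
  classical
  have h := (hasSum_isOverpartition hq norm_rankWeight_le).sum_fiber
    (g := fun p => p.1.sum) (T := overpartitions)
    (fun p hp => mem_overpartitions.mpr ⟨by by_contra h; simp [h] at hp, rfl⟩)
    (fun n p hp => (mem_overpartitions.mp hp).2)
  rw [show rankWeight 0 = 1 by simp [rankWeight]] at h
  rw [← h.tsum_eq]
  refine tsum_congr fun n => ?_
  rw [← sum_rankWeight, Finset.sum_mul]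
  refine Finset.sum_congr rfl fun p hp => ?_
  obtain ⟨hover, rfl⟩ := mem_overpartitions.mp hp
  rw [if_pos hover]

end

theorem stmt18 (q : ℂ) (hq0 : q ≠ 0) (hq : ‖q‖ < 1) :
    (∑' n : ℕ, (((Nbar 0 n : ℤ) + (Nbar 1 n : ℤ) - (Nbar 2 n : ℤ) - (Nbar 3 n : ℤ) : ℤ) : ℂ)
        * q ^ n)
      = 2 * poch (-q) q / poch q q
          * (∑' n : ℤ, (-1 : ℂ) ^ n * q ^ ((n : ℤ) ^ 2 + n) / (1 + q ^ (3 * n))) := by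
  exact (tsum_Nbar_eq_tsum_rankTerm hq).trans (appell_eq_tsum_rankWeight hq hq0)
end
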